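/- The minimizer w⋆_λ = argmin_{w ∈ ℝ^N} L_λ(w) exists and is almost surely unique. Moreover, there exist constants γ, c, C > 0 depending only on Ω such that for all θ⋆ ∈ D, all λ ∈ [λ_min, λ_max], and all ε ∈ (0, 1]: P( ∃ w ∈ ℝ^N with (1/N)‖w − w⋆_λ‖² > ε and L_λ(w) ≤ min_{v ∈ ℝ^N} L_λ(v) + γε ) ≤ (C/ε) e^{−cnε²}. -/

import Mathlib

open MeasureTheory ProbabilityTheory
open scoped ENNReal NNReal

noncomputable section

/-- Standard Gaussian density φ. -/
def gphi (x : ℝ) : ℝ := Real.exp (-x ^ 2 / 2) / Real.sqrt (2 * Real.pi)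

/-- Standard Gaussian CDF Φ. -/
def gPhi (x : ℝ) : ℝ := ∫ t in Set.Iic x, gphi t

/-- Soft thresholding η(x; b) = sign(x)(|x| − b)₊. -/
def eta (x b : ℝ) : ℝ := Real.sign x * max (|x| - b) 0

/-- Derivative in x of soft thresholding: η′(x; b) = 1_{|x| > b}. -/
def eta' (x b : ℝ) : ℝ := if b < |x| then 1 else 0

/-- The ℓ_p ball F_p(ξ) = {x : (1/N) ∑ |xᵢ|^p ≤ ξ^p}. -/
def Fball (N : ℕ) (p ξ : ℝ) : Set (Fin N → ℝ) :=
  {x | (1 / (N : ℝ)) * ∑ i, |x i| ^ p ≤ ξ ^ p}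

/-- Number of nonzero entries ‖x‖₀. -/
def l0 {N : ℕ} (x : Fin N → ℝ) : ℕ := (Finset.univ.filter fun i => x i ≠ 0).card

/-- The ℓ₀ ball F_0(s) = {x : ‖x‖₀ ≤ sN}. -/
def F0ball (N : ℕ) (s : ℝ) : Set (Fin N → ℝ) := {x | (l0 x : ℝ) ≤ s * N}

/-- The critical sparsity s_max(δ). -/
def smax (δ : ℝ) : ℝ :=
  δ * sSup ((fun α : ℝ =>
      (1 - (2 / δ) * ((1 + α ^ 2) * gPhi (-α) - α * gphi α)) /
      (1 + α ^ 2 - 2 * ((1 + α ^ 2) * gPhi (-α) - α * gphi α))) '' Set.Ici 0)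

/-- Empirical distribution of the entries of a vector. -/
def empDist {N : ℕ} (θ : Fin N → ℝ) : Measure ℝ :=
  ((N : ℝ≥0∞))⁻¹ • ∑ i : Fin N, Measure.dirac (θ i)

/-- Empirical distribution of pairs of entries of two vectors. -/
def empDist2 {N : ℕ} (u v : Fin N → ℝ) : Measure (ℝ × ℝ) :=
  ((N : ℝ≥0∞))⁻¹ • ∑ i : Fin N, Measure.dirac (u i, v i)

/-- Squared order-2 Wasserstein distance between measures on ℝ². -/
def W2sq (μ ν : Measure (ℝ × ℝ)) : ℝ :=
  sInf {r : ℝ | ∃ γ : Measure ((ℝ × ℝ) × (ℝ × ℝ)),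
    γ.map Prod.fst = μ ∧ γ.map Prod.snd = ν ∧
    r = ∫ q, ((q.1.1 - q.2.1) ^ 2 + (q.1.2 - q.2.2) ^ 2) ∂γ}

/-- Order-2 Wasserstein distance. -/
def W2 (μ ν : Measure (ℝ × ℝ)) : ℝ := Real.sqrt (W2sq μ ν)

/-- Standard Gaussian measure on ℝ. -/
def stdG : Measure ℝ := gaussianReal 0 1

/-- The state-evolution fixed point equations (for (Θ,Z) ∼ μ ⊗ N(0,1)),
together with positivity of (β, τ). -/
def StateEvo (δ σ : ℝ) (μ : Measure ℝ) (lam β τ : ℝ) : Prop :=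
  0 < β ∧ 0 < τ ∧
  τ ^ 2 = σ ^ 2 + (1 / δ) *
    ∫ q : ℝ × ℝ, (eta (q.1 + τ * q.2) (τ * lam / β) - q.1) ^ 2 ∂(μ.prod stdG) ∧
  β = τ * (1 - (1 / δ) *
    ∫ q : ℝ × ℝ, eta' (q.1 + τ * q.2) (τ * lam / β) ∂(μ.prod stdG))

/-- s⋆ = P(|Θ + τZ| ≥ ατ) for (Θ,Z) ∼ μ ⊗ N(0,1). -/
def sStar (μ : Measure ℝ) (τ α : ℝ) : ℝ :=
  ((μ.prod stdG) {q : ℝ × ℝ | α * τ ≤ |q.1 + τ * q.2|}).toReal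

/-- The limit law μ⋆: law of (η(Θ + τZ; ατ), Θ) for (Θ,Z) ∼ μ ⊗ N(0,1). -/
def muStar (μ : Measure ℝ) (τ α : ℝ) : Measure (ℝ × ℝ) :=
  (μ.prod stdG).map (fun q => (eta (q.1 + τ * q.2) (α * τ), q.1))

/-- The limit law for the debiased Lasso: law of (Θ + τZ, Θ). -/
def muStarD (μ : Measure ℝ) (τ : ℝ) : Measure (ℝ × ℝ) :=
  (μ.prod stdG).map (fun q => (q.1 + τ * q.2, q.1))

/-- Law of the design matrix: i.i.d. N(0, 1/n) entries. -/
def PX (n N : ℕ) : Measure (Fin n → Fin N → ℝ) :=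
  Measure.pi fun _ => Measure.pi fun _ => gaussianReal 0 ((n : ℝ≥0))⁻¹

/-- Law of the noise: i.i.d. standard Gaussian entries. -/
def Pz (n : ℕ) : Measure (Fin n → ℝ) :=
  Measure.pi fun _ => gaussianReal 0 1

/-- Joint law of (X, z). -/
def Pmodel (n N : ℕ) : Measure ((Fin n → Fin N → ℝ) × (Fin n → ℝ)) :=
  (PX n N).prod (Pz n)

/-- The response y = Xθ⋆ + σz. -/
def yvec {n N : ℕ} (σ : ℝ) (θstar : Fin N → ℝ) (X : Fin n → Fin N → ℝ)
    (z : Fin n → ℝ) : Fin n → ℝ :=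
  fun i => (∑ j, X i j * θstar j) + σ * z i

/-- The Lasso cost (1/(2n))‖y − Xθ‖² + (λ/n)‖θ‖₁. -/
def lassoCost {n N : ℕ} (X : Fin n → Fin N → ℝ) (y : Fin n → ℝ) (lam : ℝ)
    (θ : Fin N → ℝ) : ℝ :=
  (1 / (2 * (n : ℝ))) * ∑ i, (y i - ∑ j, X i j * θ j) ^ 2
    + (lam / (n : ℝ)) * ∑ j, |θ j|

/-- The uniformity class: D is either an ℓ_p ball F_p(ξ) or an ℓ₀ ball F_0(s) with
s below the critical sparsity, with the corresponding exponent q. -/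
def DFamSpec (δ : ℝ) (Dfam : (M : ℕ) → Set (Fin M → ℝ)) (q : ℝ) : Prop :=
  (∃ p ξ : ℝ, 0 < p ∧ 0 < ξ ∧ (∀ M, Dfam M = Fball M p ξ) ∧ q = max (1 / p - 1) 0) ∨
  (∃ s : ℝ, 0 ≤ s ∧ s < smax δ ∧ (∀ M, Dfam M = F0ball M s) ∧ q = 0)

/-- Gordon's auxiliary cost L_λ(w). -/
def gordonL (n N : ℕ) (σ lam : ℝ) (θstar : Fin N → ℝ)
    (g : Fin N → ℝ) (h : Fin n → ℝ) (g' : ℝ) (w : Fin N → ℝ) : ℝ :=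
  (1 / 2) * (max (Real.sqrt ((∑ j, (w j) ^ 2) / (n : ℝ) + σ ^ 2)
        * Real.sqrt (∑ i, (h i) ^ 2) / Real.sqrt (n : ℝ)
      - (1 / (n : ℝ)) * ∑ j, g j * w j + g' * σ / Real.sqrt (n : ℝ)) 0) ^ 2
    + (lam / (n : ℝ)) * (∑ j, |w j + θstar j| - ∑ j, |θstar j|)

/-- Joint law of the independent standard Gaussians (g, h, g′). -/
def Pgordon (n N : ℕ) : Measure ((Fin N → ℝ) × ((Fin n → ℝ) × ℝ)) :=
  (Measure.pi fun _ : Fin N => gaussianReal 0 1).prod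
    ((Measure.pi fun _ : Fin n => gaussianReal 0 1).prod (gaussianReal 0 1))

/-- The Euclidean norm of a finite real vector. -/
def euclNorm {N : ℕ} (w : Fin N → ℝ) : ℝ := Real.sqrt (∑ j, w j ^ 2)

lemma euclNorm_nonneg {N : ℕ} (w : Fin N → ℝ) : 0 ≤ euclNorm w := Real.sqrt_nonneg _

lemma sq_euclNorm {N : ℕ} (w : Fin N → ℝ) : euclNorm w ^ 2 = ∑ j, w j ^ 2 :=
  Real.sq_sqrt (Finset.sum_nonneg fun _ _ => sq_nonneg _)

lemma sum_mul_le_euclNorm {N : ℕ} (u v : Fin N → ℝ) :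
    ∑ j, u j * v j ≤ euclNorm u * euclNorm v :=
  Real.sum_mul_le_sqrt_mul_sqrt _ _ _

lemma euclNorm_add_le {N : ℕ} (u v : Fin N → ℝ) :
    euclNorm (fun j => u j + v j) ≤ euclNorm u + euclNorm v := by
  apply Real.sqrt_le_iff.2
  refine ⟨add_nonneg (euclNorm_nonneg _) (euclNorm_nonneg _), ?_⟩
  have h := sum_mul_le_euclNorm u v
  have e : ∑ j, (u j + v j) ^ 2 = ∑ j, u j ^ 2 + 2 * ∑ j, u j * v j + ∑ j, v j ^ 2 := by
    rw [Finset.mul_sum, ← Finset.sum_add_distrib, ← Finset.sum_add_distrib]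
    exact Finset.sum_congr rfl fun _ _ => by ring
  rw [e, add_sq, sq_euclNorm, sq_euclNorm]
  linarith

lemma euclNorm_const_mul {N : ℕ} (s : ℝ) (u : Fin N → ℝ) :
    euclNorm (fun j => s * u j) = |s| * euclNorm u := by
  unfold euclNorm
  rw [← Real.sqrt_sq_eq_abs, ← Real.sqrt_mul (sq_nonneg _), Finset.mul_sum]
  simp only [mul_pow]

/-- The scale `√(‖w‖²/n + σ²)`. -/
def errScale {N : ℕ} (n σ : ℝ) (w : Fin N → ℝ) : ℝ := Real.sqrt ((∑ j, w j ^ 2) / n + σ ^ 2)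

/-- The argument of the positive part in Gordon's cost. -/
def gordonInner {N : ℕ} (n σ A b : ℝ) (g w : Fin N → ℝ) : ℝ :=
  errScale n σ w * A - (1 / n) * ∑ j, g j * w j + b

/-- Gordon's cost, as a function of `A = ‖h‖/√n` and `b = g'σ/√n`. -/
def gordonCost {N : ℕ} (n σ lam A b : ℝ) (θ g w : Fin N → ℝ) : ℝ :=
  (1 / 2) * (max (gordonInner n σ A b g w) 0) ^ 2
    + (lam / n) * (∑ j, |w j + θ j| - ∑ j, |θ j|)

lemma errScale_nonneg {N : ℕ} (n σ : ℝ) (w : Fin N → ℝ) : 0 ≤ errScale n σ w :=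
  Real.sqrt_nonneg _

section
variable {N : ℕ} {n σ : ℝ}

lemma sq_errScale (hn : 0 < n) (w : Fin N → ℝ) :
    errScale n σ w ^ 2 = (∑ j, w j ^ 2) / n + σ ^ 2 :=
  Real.sq_sqrt (add_nonneg (div_nonneg (Finset.sum_nonneg fun _ _ => sq_nonneg _) hn.le)
    (sq_nonneg _))

lemma le_errScale (hn : 0 < n) (w : Fin N → ℝ) : σ ≤ errScale n σ w := by
  apply Real.le_sqrt_of_sq_le
  have : 0 ≤ (∑ j, w j ^ 2) / n :=
    div_nonneg (Finset.sum_nonneg fun _ _ => sq_nonneg _) hn.le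
  linarith

lemma euclNorm_le_errScale (hn : 0 < n) (w : Fin N → ℝ) :
    euclNorm w ≤ Real.sqrt n * errScale n σ w := by
  unfold errScale euclNorm
  rw [← Real.sqrt_mul hn.le]
  apply Real.sqrt_le_sqrt
  rw [mul_add, mul_div_cancel₀ _ hn.ne']
  have : 0 ≤ n * σ ^ 2 := by positivity
  linarith

lemma sum_mul_div_add_le (hn : 0 < n) (u v : Fin N → ℝ) :
    (∑ j, u j * v j) / n + σ ^ 2 ≤ errScale n σ u * errScale n σ v := by
  have h1 := sum_mul_le_euclNorm u v
  refine le_of_abs_le (abs_le_of_sq_le_sq ?_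
    (mul_nonneg (errScale_nonneg n σ u) (errScale_nonneg n σ v)))
  rw [mul_pow, sq_errScale hn, sq_errScale hn, ← sq_euclNorm, ← sq_euclNorm]
  have hu := euclNorm_nonneg u
  have hv := euclNorm_nonneg v
  have h2 : (∑ j, u j * v j) ^ 2 ≤ (euclNorm u * euclNorm v) ^ 2 := by
    rw [mul_pow, sq_euclNorm, sq_euclNorm]
    exact Finset.sum_mul_sq_le_sq_mul_sq _ _ _
  set a := euclNorm u
  set b := euclNorm v
  set c := ∑ j, u j * v j
  have e : (a ^ 2 / n + σ ^ 2) * (b ^ 2 / n + σ ^ 2) - (c / n + σ ^ 2) ^ 2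
      = ((a * b) ^ 2 - c ^ 2) / n ^ 2 + σ ^ 2 * ((a - b) ^ 2 + 2 * (a * b - c)) / n := by
    field_simp
    ring
  have p1 : 0 ≤ ((a * b) ^ 2 - c ^ 2) / n ^ 2 := div_nonneg (by linarith) (by positivity)
  have p2 : 0 ≤ σ ^ 2 * ((a - b) ^ 2 + 2 * (a * b - c)) / n :=
    div_nonneg (mul_nonneg (sq_nonneg _) (by nlinarith [sq_nonneg (a - b)])) hn.le
  linarith

lemma errScale_add_le (hn : 0 < n) (w d : Fin N → ℝ) :
    errScale n σ (fun j => w j + d j) ≤ errScale n σ w + euclNorm d / Real.sqrt n := by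
  have hs : 0 < Real.sqrt n := Real.sqrt_pos.2 hn
  have hd := euclNorm_nonneg d
  apply Real.sqrt_le_iff.2
  refine ⟨add_nonneg (errScale_nonneg _ _ _) (by positivity), ?_⟩
  have e : ∑ j, (w j + d j) ^ 2 = ∑ j, w j ^ 2 + 2 * ∑ j, w j * d j + ∑ j, d j ^ 2 := by
    rw [Finset.mul_sum, ← Finset.sum_add_distrib, ← Finset.sum_add_distrib]
    exact Finset.sum_congr rfl fun _ _ => by ring
  rw [e, add_sq, sq_errScale hn, div_pow, Real.sq_sqrt hn.le, sq_euclNorm]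
  have h1 := sum_mul_le_euclNorm w d
  have h2 := mul_le_mul_of_nonneg_right (euclNorm_le_errScale (σ := σ) hn w) hd
  have h3 : (∑ j, w j * d j) / n ≤ errScale n σ w * (euclNorm d / Real.sqrt n) := by
    rw [div_le_iff₀ hn]
    have : errScale n σ w * (euclNorm d / Real.sqrt n) * n
        = Real.sqrt n * errScale n σ w * euclNorm d := by
      have hd' : euclNorm d / Real.sqrt n * n = Real.sqrt n * euclNorm d := by
        rw [div_mul_eq_mul_div, div_eq_iff hs.ne', mul_right_comm, Real.mul_self_sqrt hn.le,
          mul_comm]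
      rw [mul_assoc, hd']; ring
    rw [this]; linarith
  have h4 : (∑ j, w j ^ 2 + 2 * ∑ j, w j * d j + ∑ j, d j ^ 2) / n
    = (∑ j, w j ^ 2) / n + 2 * ((∑ j, w j * d j) / n) + (∑ j, d j ^ 2) / n := by ring
  rw [h4]; linarith

lemma errScale_segment_le (hn : 0 < n) (u v : Fin N → ℝ) {s : ℝ} (h0 : 0 ≤ s) (h1 : s ≤ 1) :
    errScale n σ (fun j => (1 - s) * u j + s * v j)
      ≤ (1 - s) * errScale n σ u + s * errScale n σ v := by
  have hu := errScale_nonneg n σ u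
  have hv := errScale_nonneg n σ v
  have hs : 0 ≤ 1 - s := by linarith
  apply Real.sqrt_le_iff.2
  refine ⟨by positivity, ?_⟩
  have e : ∑ j, ((1 - s) * u j + s * v j) ^ 2
      = (1 - s) ^ 2 * ∑ j, u j ^ 2 + 2 * s * (1 - s) * ∑ j, u j * v j + s ^ 2 * ∑ j, v j ^ 2 := by
    simp only [Finset.mul_sum, ← Finset.sum_add_distrib]
    exact Finset.sum_congr rfl fun _ _ => by ring
  have h2 := mul_le_mul_of_nonneg_left (sum_mul_div_add_le (σ := σ) hn u v)
    (show 0 ≤ 2 * s * (1 - s) by positivity)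
  have h3 : ((1 - s) * errScale n σ u + s * errScale n σ v) ^ 2
      = (1 - s) ^ 2 * errScale n σ u ^ 2
        + 2 * s * (1 - s) * (errScale n σ u * errScale n σ v) + s ^ 2 * errScale n σ v ^ 2 := by
    ring
  rw [h3, sq_errScale hn, sq_errScale hn, e]
  have h4 : ((1 - s) ^ 2 * ∑ j, u j ^ 2 + 2 * s * (1 - s) * ∑ j, u j * v j
      + s ^ 2 * ∑ j, v j ^ 2) / n + σ ^ 2
    = (1 - s) ^ 2 * ((∑ j, u j ^ 2) / n + σ ^ 2)
      + 2 * s * (1 - s) * ((∑ j, u j * v j) / n + σ ^ 2)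
      + s ^ 2 * ((∑ j, v j ^ 2) / n + σ ^ 2) := by ring
  rw [h4]; linarith

lemma midpoint_scalar {σ B X Y P Q S T U : ℝ} (hσ : 0 < σ) (hXs : σ ≤ X) (hYs : σ ≤ Y)
    (hu : X ≤ B) (hv : Y ≤ B) (hX2 : X ^ 2 = P + σ ^ 2) (hY2 : Y ^ 2 = Q + σ ^ 2)
    (hc : U + σ ^ 2 ≤ X * Y) (hS0 : 0 ≤ S) (hT0 : 0 ≤ T) (hCS : (P - Q) ^ 2 ≤ S * T)
    (hST : S + T = 2 * P + 2 * Q) (hTT : T = P + Q + 2 * U) :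
    Real.sqrt ((P + Q) / 2 - S / 4 + σ ^ 2) ≤ (X + Y) / 2 - σ ^ 2 * S / (8 * B ^ 3) := by
  have hB : 0 < B := by linarith
  have hX0 : 0 < X := by linarith
  have hY0 : 0 < Y := by linarith
  have hσB : σ ^ 2 ≤ B ^ 2 := pow_le_pow_left₀ hσ.le (by linarith) 2
  have hXB : X ^ 2 ≤ B ^ 2 := pow_le_pow_left₀ hX0.le hu 2
  have hYB : Y ^ 2 ≤ B ^ 2 := pow_le_pow_left₀ hY0.le hv 2
  have hSB : S ≤ 4 * B ^ 2 := by linarith [sq_nonneg σ]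
  have hTle : T ≤ (X + Y) ^ 2 - 4 * σ ^ 2 := by nlinarith
  have hXY : (X + Y) ^ 2 ≤ 4 * B ^ 2 := by
    have := pow_le_pow_left₀ (by positivity) (show X + Y ≤ 2 * B by linarith) 2
    linarith
  have hT2 : T ≤ (X + Y) ^ 2 * (1 - σ ^ 2 / B ^ 2) := by
    have : (X + Y) ^ 2 * (σ ^ 2 / B ^ 2) ≤ 4 * σ ^ 2 := by
      rw [← mul_div_assoc, div_le_iff₀ (by positivity)]
      nlinarith [mul_le_mul_of_nonneg_left hXY (sq_nonneg σ)]
    linarith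
  have hdiff : (X - Y) ^ 2 ≤ S * (1 - σ ^ 2 / B ^ 2) := by
    have h1 : (X - Y) ^ 2 * (X + Y) ^ 2 ≤ S * (1 - σ ^ 2 / B ^ 2) * (X + Y) ^ 2 := by
      calc (X - Y) ^ 2 * (X + Y) ^ 2 = (X ^ 2 - Y ^ 2) ^ 2 := by ring
        _ = (P - Q) ^ 2 := by rw [hX2, hY2]; ring
        _ ≤ S * T := hCS
        _ ≤ S * ((X + Y) ^ 2 * (1 - σ ^ 2 / B ^ 2)) := mul_le_mul_of_nonneg_left hT2 hS0
        _ = _ := by ring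
    exact le_of_mul_le_mul_right h1 (by positivity)
  set k := σ ^ 2 * S / (8 * B ^ 3) with hk
  have hk0 : 0 ≤ k := by positivity
  have hkB : 8 * k * B = S * (σ ^ 2 / B ^ 2) := by rw [hk]; field_simp
  have hk1 : k ≤ σ / 2 := by
    rw [hk, div_le_iff₀ (by positivity)]
    calc σ ^ 2 * S ≤ σ ^ 2 * (4 * B ^ 2) := by gcongr
      _ = σ / 2 * (8 * (σ * B ^ 2)) := by ring
      _ ≤ σ / 2 * (8 * (B * B ^ 2)) := by gcongr; linarith
      _ = _ := by ring
  apply Real.sqrt_le_iff.2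
  refine ⟨by linarith, ?_⟩
  have h4 : 4 * k * (X + Y) ≤ 8 * k * B := by
    have := mul_le_mul_of_nonneg_left (add_le_add hu hv) hk0
    linarith
  have : ((X + Y) / 2 - k) ^ 2 = (X ^ 2 + Y ^ 2) / 2 - (X - Y) ^ 2 / 4 - k * (X + Y) + k ^ 2 := by
    ring
  rw [this, hX2, hY2]
  linarith [sq_nonneg k]

/-- Uniform convexity of the scale on bounded sets. -/
lemma errScale_midpoint_le (hn : 0 < n) (hσ : 0 < σ) (u v : Fin N → ℝ) {B : ℝ}
    (hu : errScale n σ u ≤ B) (hv : errScale n σ v ≤ B) :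
    errScale n σ (fun j => (u j + v j) / 2)
      ≤ (errScale n σ u + errScale n σ v) / 2
        - σ ^ 2 * ((∑ j, (u j - v j) ^ 2) / n) / (8 * B ^ 3) := by
  have hXs := le_errScale (σ := σ) hn u
  have hYs := le_errScale (σ := σ) hn v
  have hX2 := sq_errScale (σ := σ) hn u
  have hY2 := sq_errScale (σ := σ) hn v
  have hc := sum_mul_div_add_le (σ := σ) hn u v
  have hCS : (∑ j, (u j - v j) * (u j + v j)) ^ 2
      ≤ (∑ j, (u j - v j) ^ 2) * ∑ j, (u j + v j) ^ 2 := Finset.sum_mul_sq_le_sq_mul_sq _ _ _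
  have e1 : ∑ j, (u j - v j) * (u j + v j) = ∑ j, u j ^ 2 - ∑ j, v j ^ 2 := by
    rw [← Finset.sum_sub_distrib]; exact Finset.sum_congr rfl fun _ _ => by ring
  have e2 : ∑ j, (u j - v j) ^ 2
      = ∑ j, u j ^ 2 + ∑ j, v j ^ 2 - 2 * ∑ j, u j * v j := by
    rw [Finset.mul_sum, ← Finset.sum_add_distrib, ← Finset.sum_sub_distrib]
    exact Finset.sum_congr rfl fun _ _ => by ring
  have e3 : ∑ j, (u j + v j) ^ 2
      = ∑ j, u j ^ 2 + ∑ j, v j ^ 2 + 2 * ∑ j, u j * v j := by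
    rw [Finset.mul_sum, ← Finset.sum_add_distrib, ← Finset.sum_add_distrib]
    exact Finset.sum_congr rfl fun _ _ => by ring
  have e4 : ∑ j, ((u j + v j) / 2) ^ 2
      = (∑ j, u j ^ 2 + ∑ j, v j ^ 2) / 2 - (∑ j, (u j - v j) ^ 2) / 4 := by
    rw [e2]
    have : ∑ j, ((u j + v j) / 2) ^ 2 = (∑ j, (u j + v j) ^ 2) / 4 := by
      rw [Finset.sum_div]; exact Finset.sum_congr rfl fun _ _ => by ring
    rw [this, e3]; ring
  have hS0 : 0 ≤ (∑ j, (u j - v j) ^ 2) / n :=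
    div_nonneg (Finset.sum_nonneg fun _ _ => sq_nonneg _) hn.le
  have hT0 : 0 ≤ (∑ j, (u j + v j) ^ 2) / n :=
    div_nonneg (Finset.sum_nonneg fun _ _ => sq_nonneg _) hn.le
  have hCS' : ((∑ j, u j ^ 2) / n - (∑ j, v j ^ 2) / n) ^ 2
      ≤ (∑ j, (u j - v j) ^ 2) / n * ((∑ j, (u j + v j) ^ 2) / n) := by
    rw [e1] at hCS
    have := div_le_div_of_nonneg_right hCS (sq_nonneg n)
    calc _ = (∑ j, u j ^ 2 - ∑ j, v j ^ 2) ^ 2 / n ^ 2 := by ring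
      _ ≤ _ := this
      _ = _ := by ring
  have hST : (∑ j, (u j - v j) ^ 2) / n + (∑ j, (u j + v j) ^ 2) / n
      = 2 * ((∑ j, u j ^ 2) / n) + 2 * ((∑ j, v j ^ 2) / n) := by
    rw [e2, e3]; ring
  have hTT : (∑ j, (u j + v j) ^ 2) / n
      = (∑ j, u j ^ 2) / n + (∑ j, v j ^ 2) / n + 2 * ((∑ j, u j * v j) / n) := by
    rw [e3]; ring
  have e4' : (∑ j, ((u j + v j) / 2) ^ 2) / n
      = ((∑ j, u j ^ 2) / n + (∑ j, v j ^ 2) / n) / 2 - ((∑ j, (u j - v j) ^ 2) / n) / 4 := by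
    rw [e4]; ring
  rw [errScale, e4']
  exact midpoint_scalar hσ hXs hYs hu hv hX2 hY2 hc hS0 hT0 hCS' hST hTT

lemma gordonInner_add_le (hn : 0 < n) {A b Λ : ℝ} (hA : 0 ≤ A) (g w d : Fin N → ℝ)
    (hΛ : A + euclNorm g / Real.sqrt n ≤ Λ) :
    gordonInner n σ A b g (fun j => w j + d j)
      ≤ gordonInner n σ A b g w + Λ * (euclNorm d / Real.sqrt n) := by
  have hs : 0 < Real.sqrt n := Real.sqrt_pos.2 hn
  have hd := euclNorm_nonneg d
  have h1 := mul_le_mul_of_nonneg_right (errScale_add_le (σ := σ) hn w d) hA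
  have h2 : -(euclNorm g * euclNorm d) ≤ ∑ j, g j * d j := by
    have := sum_mul_le_euclNorm (fun j => -1 * g j) d
    rw [euclNorm_const_mul] at this
    simp only [neg_mul, one_mul, Finset.sum_neg_distrib, abs_neg, abs_one] at this
    linarith
  have h3 : -(euclNorm g / Real.sqrt n * (euclNorm d / Real.sqrt n)) ≤ 1 / n * ∑ j, g j * d j := by
    have := mul_le_mul_of_nonneg_left h2 (show 0 ≤ 1 / n by positivity)
    calc _ = 1 / n * -(euclNorm g * euclNorm d) := by
          nth_rw 3 [← Real.sq_sqrt hn.le]; field_simp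
      _ ≤ _ := this
  have h4 := mul_le_mul_of_nonneg_right hΛ (show 0 ≤ euclNorm d / Real.sqrt n by positivity)
  have e : ∑ j, g j * (w j + d j) = ∑ j, g j * w j + ∑ j, g j * d j := by
    rw [← Finset.sum_add_distrib]; exact Finset.sum_congr rfl fun _ _ => by ring
  unfold gordonInner
  rw [e]
  nlinarith

lemma gordonInner_segment_le (hn : 0 < n) {A b : ℝ} (hA : 0 ≤ A) (g u v : Fin N → ℝ) {s : ℝ}
    (h0 : 0 ≤ s) (h1 : s ≤ 1) :
    gordonInner n σ A b g (fun j => (1 - s) * u j + s * v j)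
      ≤ (1 - s) * gordonInner n σ A b g u + s * gordonInner n σ A b g v := by
  have h2 := mul_le_mul_of_nonneg_right (errScale_segment_le (σ := σ) hn u v h0 h1) hA
  have e : ∑ j, g j * ((1 - s) * u j + s * v j)
      = (1 - s) * ∑ j, g j * u j + s * ∑ j, g j * v j := by
    simp only [Finset.mul_sum, ← Finset.sum_add_distrib]
    exact Finset.sum_congr rfl fun _ _ => by ring
  unfold gordonInner
  rw [e]
  nlinarith

lemma gordonInner_midpoint_le (hn : 0 < n) (hσ : 0 < σ) {A b B : ℝ} (hA : 0 ≤ A)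
    (g u v : Fin N → ℝ) (hu : errScale n σ u ≤ B) (hv : errScale n σ v ≤ B) :
    gordonInner n σ A b g (fun j => (u j + v j) / 2)
      ≤ (gordonInner n σ A b g u + gordonInner n σ A b g v) / 2
        - A * (σ ^ 2 * ((∑ j, (u j - v j) ^ 2) / n) / (8 * B ^ 3)) := by
  have h2 := mul_le_mul_of_nonneg_right (errScale_midpoint_le hn hσ u v hu hv) hA
  have e : ∑ j, g j * ((u j + v j) / 2) = (∑ j, g j * u j + ∑ j, g j * v j) / 2 := by
    rw [← Finset.sum_add_distrib, Finset.sum_div]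
    exact Finset.sum_congr rfl fun _ _ => by ring
  unfold gordonInner
  rw [e]
  nlinarith

lemma sum_abs_segment_le (θ u v : Fin N → ℝ) {s : ℝ} (h0 : 0 ≤ s) (h1 : s ≤ 1) :
    ∑ j, |(1 - s) * u j + s * v j + θ j|
      ≤ (1 - s) * ∑ j, |u j + θ j| + s * ∑ j, |v j + θ j| := by
  simp only [Finset.mul_sum, ← Finset.sum_add_distrib]
  refine Finset.sum_le_sum fun j _ => ?_
  have : (1 - s) * u j + s * v j + θ j = (1 - s) * (u j + θ j) + s * (v j + θ j) := by ring
  rw [this]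
  refine (abs_add_le _ _).trans ?_
  rw [abs_mul, abs_mul, abs_of_nonneg h0, abs_of_nonneg (sub_nonneg.2 h1)]

lemma gordonCost_segment_le (hn : 0 < n) {lam A b : ℝ} (hl : 0 ≤ lam) (hA : 0 ≤ A)
    (θ g u v : Fin N → ℝ) {s : ℝ} (h0 : 0 ≤ s) (h1 : s ≤ 1) :
    gordonCost n σ lam A b θ g (fun j => (1 - s) * u j + s * v j)
      ≤ (1 - s) * gordonCost n σ lam A b θ g u + s * gordonCost n σ lam A b θ g v := by
  have hf := gordonInner_segment_le (σ := σ) (b := b) hn hA g u v h0 h1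
  have hS := mul_le_mul_of_nonneg_left (sum_abs_segment_le θ u v h0 h1)
    (show 0 ≤ lam / n by positivity)
  have hs : 0 ≤ 1 - s := by linarith
  unfold gordonCost
  set x := gordonInner n σ A b g u
  set y := gordonInner n σ A b g v
  have hm : max (gordonInner n σ A b g fun j => (1 - s) * u j + s * v j) 0
      ≤ (1 - s) * max x 0 + s * max y 0 := by
    apply max_le
    · refine hf.trans ?_
      gcongr <;> exact le_max_left _ _
    · positivity
  have hx : 0 ≤ max x 0 := le_max_right _ _
  have hy : 0 ≤ max y 0 := le_max_right _ _
  have h2 : (max (gordonInner n σ A b g fun j => (1 - s) * u j + s * v j) 0) ^ 2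
      ≤ (1 - s) * (max x 0) ^ 2 + s * (max y 0) ^ 2 := by
    have h3 := pow_le_pow_left₀ (le_max_right _ _) hm 2
    have h4 : 0 ≤ s * (1 - s) * (max x 0 - max y 0) ^ 2 := by positivity
    nlinarith
  nlinarith

end

section
variable {N : ℕ} {n σ lam A b : ℝ} {θ g : Fin N → ℝ}

lemma continuous_gordonCost : Continuous (gordonCost n σ lam A b θ g) := by
  unfold gordonCost gordonInner errScale
  fun_prop

lemma exists_isMinOn_gordonCost (hn : 0 < n) (hl : 0 < lam) :
    ∃ w, IsMinOn (gordonCost n σ lam A b θ g) Set.univ w := by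
  set R : ℝ := gordonCost n σ lam A b θ g 0 * n / lam + ∑ j, |θ j| + ∑ j, |θ j| with hR
  have key : ∀ w, gordonCost n σ lam A b θ g w ≤ gordonCost n σ lam A b θ g 0 →
      w ∈ Metric.closedBall (0 : Fin N → ℝ) (max R 0) := by
    intro w hw
    rw [mem_closedBall_zero_iff, pi_norm_le_iff_of_nonneg (le_max_right _ _)]
    intro i
    refine le_trans ?_ (le_max_left _ _)
    have h1 : lam / n * (∑ j, |w j + θ j| - ∑ j, |θ j|) ≤ gordonCost n σ lam A b θ g 0 := by
      refine le_trans ?_ hw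
      have : 0 ≤ 1 / 2 * (max (gordonInner n σ A b g w) 0) ^ 2 := by positivity
      unfold gordonCost
      linarith
    have h2 : ∑ j, |w j + θ j| - ∑ j, |θ j| ≤ gordonCost n σ lam A b θ g 0 * n / lam := by
      rw [le_div_iff₀ hl]
      rw [div_mul_eq_mul_div, div_le_iff₀ hn] at h1
      linarith
    have h3 : |w i + θ i| ≤ ∑ j, |w j + θ j| :=
      Finset.single_le_sum (f := fun j => |w j + θ j|) (fun j _ => abs_nonneg _) (Finset.mem_univ i)
    have h4 : |θ i| ≤ ∑ j, |θ j| :=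
      Finset.single_le_sum (f := fun j => |θ j|) (fun j _ => abs_nonneg _) (Finset.mem_univ i)
    have h5 : |w i| ≤ |w i + θ i| + |θ i| := by
      have := abs_sub (w i + θ i) (θ i)
      simpa using this
    rw [Real.norm_eq_abs]
    linarith
  obtain ⟨w, hw⟩ := continuous_gordonCost.exists_forall_le' (f := gordonCost n σ lam A b θ g) 0 (by
    filter_upwards [(isCompact_closedBall (0 : Fin N → ℝ) (max R 0)).compl_mem_cocompact] with w hw
    by_contra h
    exact hw (key w (not_le.1 h).le))
  exact ⟨w, fun v _ => hw v⟩

/-- First-order optimality along directions which shrink `w + θ` towards zero. -/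
lemma optimality_of_isMinOn (hn : 0 < n) (hA : 0 ≤ A) {Λ : ℝ}
    (hΛ : A + euclNorm g / Real.sqrt n ≤ Λ) {w d : Fin N → ℝ}
    (hw : IsMinOn (gordonCost n σ lam A b θ g) Set.univ w)
    (hd : ∀ j, ∀ s : ℝ, 0 ≤ s → s ≤ 1 → |w j + θ j - s * d j| = |w j + θ j| - s * |d j|) :
    lam * ∑ j, |d j| ≤ max (gordonInner n σ A b g w) 0 * Λ * Real.sqrt n * euclNorm d := by
  have hs : 0 < Real.sqrt n := Real.sqrt_pos.2 hn
  have hd0 := euclNorm_nonneg d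
  have hΛ0 : 0 ≤ Λ := le_trans (by have := euclNorm_nonneg g; positivity) hΛ
  set β := max (gordonInner n σ A b g w) 0 with hβ
  have hβ0 : 0 ≤ β := le_max_right _ _
  set D := Λ * (euclNorm d / Real.sqrt n) with hD
  have hD0 : 0 ≤ D := by positivity
  have key : ∀ s : ℝ, 0 < s → s ≤ 1 → lam / n * ∑ j, |d j| ≤ β * D + s * (D ^ 2 / 2) := by
    intro s h0 h1
    have h2 := hw (Set.mem_univ (fun j => w j + (-s) * d j))
    have h3 := gordonInner_add_le (σ := σ) (b := b) hn hA g w (fun j => (-s) * d j) hΛ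
    rw [euclNorm_const_mul, abs_neg, abs_of_pos h0] at h3
    have h4 : max (gordonInner n σ A b g fun j => w j + (-s) * d j) 0 ≤ β + s * D := by
      apply max_le
      · refine h3.trans ?_
        have : Λ * (s * euclNorm d / Real.sqrt n) = s * D := by rw [hD]; ring
        rw [this]
        gcongr
        exact le_max_left _ _
      · positivity
    have h5 := pow_le_pow_left₀ (le_max_right _ _) h4 2
    have e : ∑ j, |w j + (-s) * d j + θ j| = ∑ j, |w j + θ j| - s * ∑ j, |d j| := by
      rw [Finset.mul_sum, ← Finset.sum_sub_distrib]
      refine Finset.sum_congr rfl fun j _ => ?_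
      rw [← hd j s h0.le h1]
      congr 1; ring
    have h6 : gordonCost n σ lam A b θ g w
        ≤ gordonCost n σ lam A b θ g (fun j => w j + (-s) * d j) := h2
    unfold gordonCost at h6
    rw [e, ← hβ] at h6
    have h7 : s * (lam / n * ∑ j, |d j|) ≤ s * (β * D + s * (D ^ 2 / 2)) := by
      nlinarith
    exact le_of_mul_le_mul_left h7 h0
  have h1 : lam / n * ∑ j, |d j| ≤ β * D := by
    refine le_of_forall_pos_le_add fun ε hε => ?_
    set s := min 1 (ε / (D ^ 2 / 2 + 1)) with hs'
    have hs0 : 0 < s := lt_min one_pos (by positivity)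
    refine (key s hs0 (min_le_left _ _)).trans ?_
    have : s * (D ^ 2 / 2) ≤ ε := by
      calc s * (D ^ 2 / 2) ≤ ε / (D ^ 2 / 2 + 1) * (D ^ 2 / 2 + 1) := by
            gcongr
            · exact min_le_right _ _
            · linarith
        _ = ε := by field_simp
    linarith
  have h2 := mul_le_mul_of_nonneg_left h1 hn.le
  calc lam * ∑ j, |d j| = n * (lam / n * ∑ j, |d j|) := by field_simp
    _ ≤ n * (β * D) := h2
    _ = β * Λ * (n / Real.sqrt n) * euclNorm d := by rw [hD]; ring
    _ = _ := by rw [Real.div_sqrt]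

lemma abs_sub_mul_self_of_mem {x s : ℝ} (h1 : s ≤ 1) : |x - s * x| = |x| - s * |x| := by
  have : x - s * x = (1 - s) * x := by ring
  rw [this, abs_mul, abs_of_nonneg (sub_nonneg.2 h1)]; ring

lemma isMinOn_gordonCost_unique (hn : 0 < n) (hσ : 0 < σ) (hl : 0 < lam) (hA : 0 < A)
    {u v : Fin N → ℝ} (hu : IsMinOn (gordonCost n σ lam A b θ g) Set.univ u)
    (hv : IsMinOn (gordonCost n σ lam A b θ g) Set.univ v) : u = v := by
  have hzero : ∀ w, IsMinOn (gordonCost n σ lam A b θ g) Set.univ w →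
      max (gordonInner n σ A b g w) 0 = 0 → ∀ j, w j = - θ j := by
    intro w hw h0 j
    have h1 := optimality_of_isMinOn (d := fun j => w j + θ j) hn hA.le le_rfl hw
      (fun j s _ h1 => abs_sub_mul_self_of_mem h1)
    rw [h0] at h1
    have h3 : |w j + θ j| ≤ ∑ j, |w j + θ j| :=
      Finset.single_le_sum (f := fun j => |w j + θ j|) (fun j _ => abs_nonneg _) (Finset.mem_univ j)
    have h4 : ∑ j, |w j + θ j| ≤ 0 := by
      simp only [zero_mul] at h1
      exact nonpos_of_mul_nonpos_right h1 hl
    have := abs_nonpos_iff.1 (h3.trans h4)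
    linarith
  by_contra hne
  set p := max (gordonInner n σ A b g u) 0 with hp
  set q := max (gordonInner n σ A b g v) 0 with hq
  have hp0 : 0 ≤ p := le_max_right _ _
  have hq0 : 0 ≤ q := le_max_right _ _
  by_cases hpq : p + q = 0
  · have h1 := hzero u hu (by linarith)
    have h2 := hzero v hv (by linarith)
    exact hne (funext fun j => by rw [h1, h2])
  have hpq' : 0 < p + q := lt_of_le_of_ne (by linarith) (Ne.symm hpq)
  have hB := gordonInner_midpoint_le (b := b) (B := max (errScale n σ u) (errScale n σ v))
    hn hσ hA.le g u v (le_max_left _ _) (le_max_right _ _)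
  have hBpos : 0 < max (errScale n σ u) (errScale n σ v) :=
    lt_of_lt_of_le hσ ((le_errScale hn u).trans (le_max_left _ _))
  have hS : 0 < ∑ j, (u j - v j) ^ 2 := by
    obtain ⟨i, hi⟩ := Function.ne_iff.1 hne
    exact Finset.sum_pos' (fun j _ => sq_nonneg _)
      ⟨i, Finset.mem_univ _, by have := sub_ne_zero.2 hi; positivity⟩
  have hk : 0 < A * (σ ^ 2 * ((∑ j, (u j - v j) ^ 2) / n)
      / (8 * (max (errScale n σ u) (errScale n σ v)) ^ 3)) := by positivity
  have hm : max (gordonInner n σ A b g fun j => (u j + v j) / 2) 0 < (p + q) / 2 := by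
    apply max_lt
    · have h1 : gordonInner n σ A b g u ≤ p := le_max_left _ _
      have h2 : gordonInner n σ A b g v ≤ q := le_max_left _ _
      linarith
    · linarith
  have hm2 := pow_lt_pow_left₀ hm (le_max_right _ _) two_ne_zero
  have hs := sum_abs_segment_le θ u v (s := 1 / 2) (by norm_num) (by norm_num)
  have e : ∀ j, (1 - 1 / 2 : ℝ) * u j + 1 / 2 * v j + θ j = (u j + v j) / 2 + θ j := fun j => by
    ring
  simp only [e] at hs
  have hs' := mul_le_mul_of_nonneg_left hs (show 0 ≤ lam / n by positivity)
  have m1 : gordonCost n σ lam A b θ g u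
      ≤ gordonCost n σ lam A b θ g (fun j => (u j + v j) / 2) := hu (Set.mem_univ _)
  have m2 : gordonCost n σ lam A b θ g v
      ≤ gordonCost n σ lam A b θ g (fun j => (u j + v j) / 2) := hv (Set.mem_univ _)
  unfold gordonCost at m1 m2
  rw [← hp] at m1
  rw [← hq] at m2
  nlinarith [sq_nonneg (p - q)]

end

section
variable {N : ℕ} {n σ lam A b : ℝ} {θ g : Fin N → ℝ}

/-- A dual certificate `v` bounds the scale of the minimizer. -/
lemma errScale_le_of_certificate {δ α t b1 b2 lmin lmax : ℝ} (hδ : 0 < δ) (hn : n = δ * N)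
    (hN : 0 < N) (hσ : 0 < σ) (hα : 0 < α) (hb1 : 0 ≤ b1) (hb : b1 < b2) (hlmin : 0 < lmin)
    (hl1 : lmin ≤ lam) (hl2 : lam ≤ lmax) (hA : b2 ≤ A) (hA2 : A ≤ 2) (hbσ : |b| ≤ σ)
    {v w : Fin N → ℝ} (hw : IsMinOn (gordonCost n σ lam A b θ g) Set.univ w)
    (hv : ∀ j, v j * w j ≤ |w j + θ j| - |θ j| + 2 * t)
    (hu : ∑ j, (g j - α * v j) ^ 2 ≤ b1 ^ 2 * n) :
    errScale n σ w ≤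
      (2 * α * t / δ + σ + α * (9 * σ ^ 2 / 2) / lmin + lmax / (2 * α)) / (b2 - b1) := by
  have hN' : (0 : ℝ) < N := by exact_mod_cast hN
  have hn0 : 0 < n := by rw [hn]; positivity
  have hl : 0 < lam := by linarith
  have hsn : 0 < Real.sqrt n := Real.sqrt_pos.2 hn0
  have hW := errScale_nonneg n σ w
  set W := errScale n σ w with hWdef
  set D := (∑ j, |w j + θ j| - ∑ j, |θ j|) / n with hD
  have hvw : ∑ j, v j * w j ≤ n * D + 2 * t * N := by
    calc ∑ j, v j * w j ≤ ∑ j, (|w j + θ j| - |θ j| + 2 * t) := Finset.sum_le_sum fun j _ => hv j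
      _ = n * D + 2 * t * N := by
        rw [Finset.sum_add_distrib, Finset.sum_sub_distrib, hD, mul_div_cancel₀ _ hn0.ne']
        simp; ring
  have hun : euclNorm (fun j => g j - α * v j) ≤ b1 * Real.sqrt n := by
    apply Real.sqrt_le_iff.2
    refine ⟨by positivity, ?_⟩
    rw [mul_pow, Real.sq_sqrt hn0.le]; exact hu
  have hgw : ∑ j, g j * w j ≤ n * (b1 * W) + α * (n * D + 2 * t * N) := by
    have e : ∑ j, g j * w j = ∑ j, (g j - α * v j) * w j + α * ∑ j, v j * w j := by
      rw [Finset.mul_sum, ← Finset.sum_add_distrib]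
      exact Finset.sum_congr rfl fun _ _ => by ring
    have h1 := sum_mul_le_euclNorm (fun j => g j - α * v j) w
    have h2 : euclNorm (fun j => g j - α * v j) * euclNorm w
        ≤ (b1 * Real.sqrt n) * (Real.sqrt n * W) :=
      mul_le_mul hun (euclNorm_le_errScale hn0 w) (euclNorm_nonneg _) (by positivity)
    have h3 : (b1 * Real.sqrt n) * (Real.sqrt n * W) = n * (b1 * W) := by
      calc _ = (Real.sqrt n * Real.sqrt n) * (b1 * W) := by ring
        _ = _ := by rw [Real.mul_self_sqrt hn0.le]
    have h4 := mul_le_mul_of_nonneg_left hvw hα.le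
    rw [e]; linarith
  have hNn : (N : ℝ) / n = 1 / δ := by rw [hn]; field_simp
  have hgw' : 1 / n * ∑ j, g j * w j ≤ b1 * W + α * D + 2 * α * t / δ := by
    calc 1 / n * ∑ j, g j * w j ≤ 1 / n * (n * (b1 * W) + α * (n * D + 2 * t * N)) :=
          mul_le_mul_of_nonneg_left hgw (by positivity)
      _ = b1 * W + α * D + 2 * α * t * (N / n) := by field_simp; ring
      _ = _ := by rw [hNn]; ring
  have hF : (b2 - b1) * W - α * D - (2 * α * t / δ + σ) ≤ gordonInner n σ A b g w := by
    have h1 : b2 * W ≤ W * A := by rw [mul_comm]; exact mul_le_mul_of_nonneg_left hA hW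
    have h2 := (abs_le.1 hbσ).1
    unfold gordonInner
    rw [← hWdef]
    linarith
  set F := max (gordonInner n σ A b g w) 0 with hFdef
  have hF' : gordonInner n σ A b g w ≤ F := le_max_left _ _
  have h0 : 1 / 2 * F ^ 2 + lam * D ≤ 9 * σ ^ 2 / 2 := by
    have h1 : gordonCost n σ lam A b θ g w ≤ gordonCost n σ lam A b θ g (fun _ => 0) :=
      hw (Set.mem_univ _)
    have h2 : errScale n σ (fun _ : Fin N => (0 : ℝ)) = σ := by
      unfold errScale; simp [Real.sqrt_sq hσ.le]
    have h3 : max (gordonInner n σ A b g (fun _ => 0)) 0 ≤ 3 * σ := by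
      apply max_le _ (by positivity)
      unfold gordonInner
      rw [h2]
      have := (abs_le.1 hbσ).2
      simp only [mul_zero, Finset.sum_const_zero]
      nlinarith
    have h4 := pow_le_pow_left₀ (le_max_right _ _) h3 2
    unfold gordonCost at h1
    simp only [zero_add, sub_self, mul_zero, add_zero] at h1
    have e : lam / n * (∑ j, |w j + θ j| - ∑ j, |θ j|) = lam * D := by rw [hD]; ring
    rw [e] at h1
    linarith
  rw [le_div_iff₀ (by linarith)]
  have hFq : F - α / (2 * lam) * F ^ 2 ≤ lam / (2 * α) := by
    have : lam / (2 * α) - (F - α / (2 * lam) * F ^ 2) = (lam - α * F) ^ 2 / (2 * α * lam) := by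
      field_simp; ring
    have h2 : 0 ≤ (lam - α * F) ^ 2 / (2 * α * lam) := by positivity
    linarith
  have hαD : α * D ≤ α * (9 * σ ^ 2 / 2) / lam - α / (2 * lam) * F ^ 2 := by
    have : α * D = α / lam * (lam * D) := by field_simp
    rw [this]
    calc α / lam * (lam * D) ≤ α / lam * (9 * σ ^ 2 / 2 - 1 / 2 * F ^ 2) :=
          mul_le_mul_of_nonneg_left (by linarith) (by positivity)
      _ = _ := by field_simp
  have h5 : α * (9 * σ ^ 2 / 2) / lam ≤ α * (9 * σ ^ 2 / 2) / lmin := by gcongr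
  have h6 : lam / (2 * α) ≤ lmax / (2 * α) := by gcongr
  linarith

/-- Truncation of a real number to `[-a, a]`. -/
def clip (a x : ℝ) : ℝ := max (-a) (min a x)

lemma abs_clip_le {a : ℝ} (ha : 0 ≤ a) (x : ℝ) : |clip a x| ≤ a :=
  abs_le.2 ⟨le_max_left _ _, max_le (by linarith) (min_le_left _ _)⟩

lemma sq_sub_clip {a : ℝ} (ha : 0 ≤ a) (x : ℝ) : (x - clip a x) ^ 2 = max (|x| - a) 0 ^ 2 := by
  unfold clip
  rcases le_total x a with h1 | h1
  · rw [min_eq_right h1]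
    rcases le_total (-a) x with h2 | h2
    · rw [max_eq_right h2, max_eq_right (sub_nonpos.2 (abs_le.2 ⟨h2, h1⟩))]; ring
    · have hx : x ≤ 0 := by linarith
      rw [max_eq_left h2, abs_of_nonpos hx, max_eq_left (by linarith)]; ring
  · have hx : 0 ≤ x := by linarith
    rw [min_eq_left h1, max_eq_right (by linarith), abs_of_nonneg hx, max_eq_left (by linarith)]

/-- The restriction of `θ` to its entries of modulus at most `m`. -/
def smallPart (m x : ℝ) : ℝ := if |x| ≤ m then x else 0

set_option maxHeartbeats 1000000 in
/-- At a minimizer of bounded scale, the inner function is bounded away from zero. -/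
lemma gordonInner_ge_of_isMinOn {δ a B M κ Λ : ℝ} (hδ : 0 < δ) (hn : n = δ * N)
    (hN : 0 < N) (hσ : 0 < σ) (hl : 0 < lam) (hA : 3 / 4 ≤ A) (ha : 0 < a)
    (hB : 0 < B) (hM : M = 16 * a * B) (hκ : 0 ≤ κ) (hκ1 : a * κ ≤ 1 / 16)
    (hκ2 : a * κ * (B + 2 * M / Real.sqrt δ) ≤ σ / 16)
    (hΛ : A + euclNorm g / Real.sqrt n ≤ Λ)
    {w : Fin N → ℝ} (hw : IsMinOn (gordonCost n σ lam A b θ g) Set.univ w)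
    (hwB : errScale n σ w ≤ B) (hbσ : |b| ≤ σ / 16)
    (hg1 : ∑ j, max (|g j| - a) 0 ^ 2 ≤ n / 256)
    (hg2 : ∑ j, -(clip a (g j) * smallPart (2 * M) (θ j)) ≤ σ / 16 * n) :
    min (σ / 4) (κ * lam / Λ) ≤ gordonInner n σ A b g w := by
  by_contra hlt
  push Not at hlt
  have hN' : (0 : ℝ) < N := by exact_mod_cast hN
  have hn0 : 0 < n := by rw [hn]; positivity
  have hsn : 0 < Real.sqrt n := Real.sqrt_pos.2 hn0
  have hM0 : 0 < M := by rw [hM]; positivity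
  have hΛ0 : 0 < Λ := by
    have := euclNorm_nonneg g
    have h2 : 0 ≤ euclNorm g / Real.sqrt n := by positivity
    linarith
  have hWσ := le_errScale (σ := σ) hn0 w
  have hwW := euclNorm_le_errScale (σ := σ) hn0 w
  have hw0 := euclNorm_nonneg w
  set W := errScale n σ w with hW
  have hW0 : 0 ≤ W := hσ.le.trans hWσ
  have hβ : max (gordonInner n σ A b g w) 0 ≤ κ * lam / Λ :=
    max_le (hlt.le.trans (min_le_right _ _)) (by positivity)
  have hopt : ∀ d : Fin N → ℝ,
      (∀ j, ∀ s : ℝ, 0 ≤ s → s ≤ 1 → |w j + θ j - s * d j| = |w j + θ j| - s * |d j|) →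
      ∑ j, |d j| ≤ κ * Real.sqrt n * euclNorm d := by
    intro d hd
    have h1 := optimality_of_isMinOn hn0 (by linarith) hΛ hw hd
    have h2 : max (gordonInner n σ A b g w) 0 * Λ * Real.sqrt n * euclNorm d
        ≤ κ * lam / Λ * Λ * Real.sqrt n * euclNorm d := by
      have := euclNorm_nonneg d
      gcongr
    have h3 : κ * lam / Λ * Λ * Real.sqrt n * euclNorm d
        = lam * (κ * Real.sqrt n * euclNorm d) := by field_simp
    exact le_of_mul_le_mul_left (by linarith) hl
  -- the part of `w + θ` on the small entries of `θ`
  set y : Fin N → ℝ := fun j => if |θ j| ≤ 2 * M then w j + θ j else 0 with hy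
  have hy1 : ∑ j, |y j| ≤ κ * Real.sqrt n * euclNorm y := by
    refine hopt y fun j s _ h1 => ?_
    simp only [hy]
    split_ifs
    · exact abs_sub_mul_self_of_mem h1
    · simp
  have hyn : euclNorm y ≤ Real.sqrt n * (B + 2 * M / Real.sqrt δ) := by
    have h1 : euclNorm y ≤ euclNorm (fun j => |w j| + 2 * M) := by
      apply Real.sqrt_le_sqrt
      refine Finset.sum_le_sum fun j _ => ?_
      simp only [hy]
      split_ifs with h
      · rw [← sq_abs]
        gcongr
        exact (abs_add_le _ _).trans (by linarith)
      · rw [zero_pow two_ne_zero]; positivity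
    have h2 := euclNorm_add_le (fun j => |w j|) (fun _ => 2 * M)
    have h3 : euclNorm (fun j => |w j|) = euclNorm w := by unfold euclNorm; simp only [sq_abs]
    have h4 : euclNorm (fun _ : Fin N => 2 * M) = Real.sqrt n * (2 * M / Real.sqrt δ) := by
      unfold euclNorm
      simp only [Finset.sum_const, Finset.card_univ, Fintype.card_fin, nsmul_eq_mul]
      rw [hn, Real.sqrt_mul hN'.le, Real.sqrt_sq (by positivity), Real.sqrt_mul hδ.le]
      have := Real.sqrt_pos.2 hδ
      field_simp
    have h5 : Real.sqrt n * W ≤ Real.sqrt n * B := by gcongr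
    rw [h3, h4] at h2
    linarith
  -- the coordinates where `w + θ` is large
  set χ : Fin N → ℝ := fun j => if M ≤ |w j + θ j| then 1 else 0 with hχ
  have hχn : euclNorm χ ≤ κ * Real.sqrt n := by
    have h1 := hopt (fun j => if M ≤ |w j + θ j| then M * SignType.sign (w j + θ j) else 0) (by
      intro j s h0 h1
      split_ifs with h
      · rcases lt_trichotomy (w j + θ j) 0 with hx | hx | hx
        · rw [sign_neg hx, abs_of_neg hx] at *
          rw [abs_of_nonpos (by simp; nlinarith)]
          simp [abs_of_pos hM0]; ring
        · rw [hx] at h; simp at h; linarith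
        · rw [sign_pos hx, abs_of_pos hx] at *
          rw [abs_of_nonneg (by simp; nlinarith)]
          simp [abs_of_pos hM0]
      · simp)
    have h2 : ∀ j, |if M ≤ |w j + θ j| then M * (SignType.sign (w j + θ j) : ℝ) else 0|
        = M * χ j ^ 2 := by
      intro j
      simp only [hχ]
      split_ifs with h
      · have : w j + θ j ≠ 0 := by
          intro h0; rw [h0] at h; simp at h; linarith
        rcases lt_or_gt_of_ne this with hx | hx
        · rw [sign_neg hx]; simp [abs_of_pos hM0]
        · rw [sign_pos hx]; simp [abs_of_pos hM0]
      · simp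
    have h3 : euclNorm (fun j => if M ≤ |w j + θ j| then
        M * (SignType.sign (w j + θ j) : ℝ) else 0) = M * euclNorm χ := by
      rw [← abs_of_pos hM0, ← euclNorm_const_mul, abs_of_pos hM0]
      unfold euclNorm
      congr 1
      refine Finset.sum_congr rfl fun j _ => ?_
      rw [← sq_abs, h2 j]
      simp only [hχ]
      split_ifs <;> ring
    rw [h3] at h1
    simp only [h2] at h1
    rw [← Finset.mul_sum, ← sq_euclNorm] at h1
    rcases (euclNorm_nonneg χ).eq_or_lt with h0 | h0
    · rw [← h0]; positivity
    · have : M * euclNorm χ * euclNorm χ ≤ M * euclNorm χ * (κ * Real.sqrt n) := by linarith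
      exact le_of_mul_le_mul_left this (by positivity)
  have hpt : ∀ j, g j * w j ≤ (g j - clip a (g j)) * w j
      + -(clip a (g j) * smallPart (2 * M) (θ j)) + a * |y j| + a * (χ j * |w j|)
      + a / M * w j ^ 2 := by
    intro j
    have hc := abs_clip_le ha.le (g j)
    have hcw : ∀ z, clip a (g j) * z ≤ a * |z| := fun z =>
      (le_abs_self _).trans (by rw [abs_mul]; gcongr)
    have hχ0 : 0 ≤ χ j := by simp only [hχ]; split_ifs <;> norm_num
    have p1 : 0 ≤ a / M * w j ^ 2 := by positivity
    have p2 : 0 ≤ a * (χ j * |w j|) := by positivity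
    have p3 : 0 ≤ a * |y j| := by positivity
    suffices h : clip a (g j) * w j ≤ -(clip a (g j) * smallPart (2 * M) (θ j)) + a * |y j|
        + a * (χ j * |w j|) + a / M * w j ^ 2 by linarith
    by_cases hθ : |θ j| ≤ 2 * M
    · have e1 : y j = w j + θ j := by simp [hy, hθ]
      have e2 : smallPart (2 * M) (θ j) = θ j := by simp [smallPart, hθ]
      have := hcw (y j)
      rw [e2]
      rw [e1] at this ⊢
      rw [e1] at p3
      linarith
    · have e2 : smallPart (2 * M) (θ j) = 0 := by simp [smallPart, hθ]
      rw [e2]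
      by_cases hx : M ≤ |w j + θ j|
      · have e3 : χ j = 1 := by simp [hχ, hx]
        rw [e3] at *
        have := hcw (w j)
        linarith
      · have h1 : M ≤ |w j| := by
          have := abs_sub (w j + θ j) (w j)
          simp only [add_sub_cancel_left] at this
          linarith
        have h2 : |w j| ≤ w j ^ 2 / M := by
          rw [le_div_iff₀ hM0, ← sq_abs]
          nlinarith [abs_nonneg (w j)]
        have h3 := mul_le_mul_of_nonneg_left h2 ha.le
        have := hcw (w j)
        have e : a * (w j ^ 2 / M) = a / M * w j ^ 2 := by ring
        linarith
  have hsum : ∑ j, g j * w j ≤ ∑ j, (g j - clip a (g j)) * w j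
      + ∑ j, -(clip a (g j) * smallPart (2 * M) (θ j)) + a * ∑ j, |y j| + a * ∑ j, χ j * |w j|
      + a / M * ∑ j, w j ^ 2 := by
    simp only [Finset.mul_sum, ← Finset.sum_add_distrib]
    exact Finset.sum_le_sum fun j _ => hpt j
  have hss : Real.sqrt n * Real.sqrt n = n := Real.mul_self_sqrt hn0.le
  have t1 : ∑ j, (g j - clip a (g j)) * w j ≤ n * (W / 16) := by
    have h1 := sum_mul_le_euclNorm (fun j => g j - clip a (g j)) w
    have h2 : euclNorm (fun j => g j - clip a (g j)) ≤ Real.sqrt n / 16 := by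
      apply Real.sqrt_le_iff.2
      refine ⟨by positivity, ?_⟩
      simp only [sq_sub_clip ha.le]
      rw [div_pow, Real.sq_sqrt hn0.le]
      norm_num; exact hg1
    calc _ ≤ _ := h1
      _ ≤ Real.sqrt n / 16 * (Real.sqrt n * W) :=
        mul_le_mul h2 hwW hw0 (by positivity)
      _ = Real.sqrt n * Real.sqrt n * (W / 16) := by ring
      _ = _ := by rw [hss]
  have t3 : a * ∑ j, |y j| ≤ n * (σ / 16) := by
    calc a * ∑ j, |y j| ≤ a * (κ * Real.sqrt n * (Real.sqrt n * (B + 2 * M / Real.sqrt δ))) := by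
          refine mul_le_mul_of_nonneg_left (hy1.trans ?_) ha.le
          gcongr
      _ = (Real.sqrt n * Real.sqrt n) * (a * κ * (B + 2 * M / Real.sqrt δ)) := by ring
      _ ≤ _ := by rw [hss]; gcongr
  have t4 : a * ∑ j, χ j * |w j| ≤ n * (W / 16) := by
    have h1 := sum_mul_le_euclNorm χ (fun j => |w j|)
    have h3 : euclNorm (fun j => |w j|) = euclNorm w := by unfold euclNorm; simp only [sq_abs]
    rw [h3] at h1
    calc a * ∑ j, χ j * |w j| ≤ a * (κ * Real.sqrt n * (Real.sqrt n * W)) := by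
          refine mul_le_mul_of_nonneg_left (h1.trans ?_) ha.le
          exact mul_le_mul hχn hwW hw0 (by positivity)
      _ = (Real.sqrt n * Real.sqrt n) * (a * κ * W) := by ring
      _ ≤ n * (1 / 16 * W) := by rw [hss]; gcongr
      _ = _ := by ring
  have t5 : a / M * ∑ j, w j ^ 2 ≤ n * (W / 16) := by
    rw [← sq_euclNorm]
    calc a / M * euclNorm w ^ 2 ≤ a / M * (Real.sqrt n * W) ^ 2 := by gcongr
      _ = (Real.sqrt n * Real.sqrt n) * (a / M * W * W) := by ring
      _ ≤ n * (a / M * W * B) := by rw [hss]; gcongr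
      _ = _ := by rw [hM]; field_simp
  have hfin : 1 / n * ∑ j, g j * w j ≤ 3 * (W / 16) + 2 * (σ / 16) := by
    calc 1 / n * ∑ j, g j * w j ≤ 1 / n * (n * (3 * (W / 16) + 2 * (σ / 16))) :=
          mul_le_mul_of_nonneg_left (by linarith) (by positivity)
      _ = _ := by field_simp
  have h1 := hlt.trans_le (min_le_left _ _)
  have h2 := (abs_le.1 hbσ).1
  have h3 : W * (3 / 4) ≤ W * A := by gcongr
  unfold gordonInner at h1
  rw [← hW] at h1
  linarith

set_option maxHeartbeats 1000000 in
/-- Local stability of the minimizer once the inner function is bounded below there. -/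
lemma cost_gap_of_gordonInner_ge {δ B c0 Λ r γ ε : ℝ} (hδ : 0 < δ) (hn : n = δ * N)
    (hN : 0 < N) (hσ : 0 < σ) (hl : 0 < lam) (hA : 1 / 2 ≤ A) (hB : 0 < B) (hc0 : 0 < c0)
    (hΛ : A + euclNorm g / Real.sqrt n ≤ Λ) (hr : 0 < r) (hr1 : r ≤ 1)
    (hrc : Λ * Real.sqrt (r / δ) ≤ c0)
    (hγ : γ = c0 * σ ^ 2 * r / (32 * (B + 1 / Real.sqrt δ) ^ 3 * δ))
    (hε : 0 < ε) (hε1 : ε ≤ 1)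
    {u w : Fin N → ℝ} (hu : IsMinOn (gordonCost n σ lam A b θ g) Set.univ u)
    (huB : errScale n σ u ≤ B) (hc : c0 ≤ gordonInner n σ A b g u)
    (hw : ε < 1 / (N : ℝ) * ∑ j, (w j - u j) ^ 2) :
    gordonCost n σ lam A b θ g u + γ * ε < gordonCost n σ lam A b θ g w := by
  by_contra hle
  push Not at hle
  have hN' : (0 : ℝ) < N := by exact_mod_cast hN
  have hn0 : 0 < n := by rw [hn]; positivity
  have hsn : 0 < Real.sqrt n := Real.sqrt_pos.2 hn0
  have hsδ : 0 < Real.sqrt δ := Real.sqrt_pos.2 hδ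
  have hΛ0 : 0 ≤ Λ := by
    have := euclNorm_nonneg g
    have h2 : 0 ≤ euclNorm g / Real.sqrt n := by positivity
    linarith
  have hγ0 : 0 < γ := by rw [hγ]; positivity
  set Q := ∑ j, (w j - u j) ^ 2 with hQ
  have hQ1 : ε * N < Q := by
    rw [one_div, inv_mul_eq_div, lt_div_iff₀ hN'] at hw; exact hw
  have hQ0 : 0 < Q := lt_trans (by positivity) hQ1
  set s := Real.sqrt (r * ε * N / Q) with hs
  have hs0 : 0 ≤ s := Real.sqrt_nonneg _
  have hs2 : s ^ 2 = r * ε * N / Q := Real.sq_sqrt (by positivity)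
  have hs1 : s ≤ 1 := by
    apply Real.sqrt_le_one.2
    rw [div_le_one hQ0]
    have : r * (ε * N) ≤ 1 * (ε * N) := by gcongr
    linarith
  set v : Fin N → ℝ := fun j => (1 - s) * u j + s * w j with hv
  have hvu : ∀ j, v j = u j + s * (w j - u j) := fun j => by simp only [hv]; ring
  have hdist : ∑ j, (s * (w j - u j)) ^ 2 = r * ε * N := by
    simp only [mul_pow]
    rw [← Finset.mul_sum, hs2, ← hQ]; field_simp
  have hdist' : euclNorm (fun j => s * (w j - u j)) / Real.sqrt n ≤ Real.sqrt (r / δ) := by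
    unfold euclNorm
    rw [hdist, ← Real.sqrt_div (by positivity)]
    apply Real.sqrt_le_sqrt
    rw [hn, div_le_div_iff₀ (by positivity) hδ]
    have : ε * (r * N * δ) ≤ 1 * (r * N * δ) := by gcongr
    linarith
  have hsr : Real.sqrt (r / δ) ≤ 1 / Real.sqrt δ := by
    rw [Real.sqrt_div hr.le]
    gcongr
    exact Real.sqrt_le_one.2 hr1
  set B' := B + 1 / Real.sqrt δ with hB'
  have hBB' : B ≤ B' := by rw [hB']; have : 0 < 1 / Real.sqrt δ := by positivity
                           linarith
  have hvB : errScale n σ v ≤ B' := by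
    have h1 := errScale_add_le (σ := σ) hn0 u (fun j => s * (w j - u j))
    simp only [← hvu] at h1
    linarith
  have hB'0 : 0 < B' := by linarith
  have hLv : gordonCost n σ lam A b θ g v ≤ gordonCost n σ lam A b θ g u + γ * ε := by
    have h1 := gordonCost_segment_le (σ := σ) (b := b) hn0 hl.le (by linarith : 0 ≤ A) θ g u w
      hs0 hs1
    have h2 : s * gordonCost n σ lam A b θ g w
        ≤ s * (gordonCost n σ lam A b θ g u + γ * ε) := by gcongr
    have h3 : s * (γ * ε) ≤ 1 * (γ * ε) := by gcongr
    linarith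
  have hmid := gordonInner_midpoint_le (b := b) hn0 hσ (by linarith : 0 ≤ A) g u v
    (huB.trans hBB') hvB
  have hmidge : c0 / 2 ≤ gordonInner n σ A b g (fun j => (u j + v j) / 2) := by
    have h1 := gordonInner_add_le (σ := σ) (b := b) hn0 (by linarith : 0 ≤ A) g
      (fun j => (u j + v j) / 2) (fun j => (-1 / 2) * (s * (w j - u j))) hΛ
    rw [euclNorm_const_mul] at h1
    have e : (fun j => (u j + v j) / 2 + (-1 / 2) * (s * (w j - u j))) = u := by
      funext j; rw [hvu]; ring
    rw [e] at h1
    have h2 : |(-1 / 2 : ℝ)| = 1 / 2 := by norm_num [abs_of_neg]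
    rw [h2] at h1
    have h3 : Λ * (1 / 2 * euclNorm (fun j => s * (w j - u j)) / Real.sqrt n)
        ≤ 1 / 2 * (Λ * Real.sqrt (r / δ)) := by
      have := mul_le_mul_of_nonneg_left hdist' hΛ0
      calc _ = 1 / 2 * (Λ * (euclNorm (fun j => s * (w j - u j)) / Real.sqrt n)) := by ring
        _ ≤ _ := by linarith
    linarith
  have hSuv : ∑ j, (u j - v j) ^ 2 = r * ε * N := by
    rw [← hdist]
    exact Finset.sum_congr rfl fun j _ => by rw [hvu]; ring
  set ψ := A * (σ ^ 2 * ((∑ j, (u j - v j) ^ 2) / n) / (8 * B' ^ 3)) with hψ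
  have hψ1 : σ ^ 2 * r * ε / (16 * B' ^ 3 * δ) ≤ ψ := by
    rw [hψ, hSuv]
    have e : r * ε * N / n = r * ε / δ := by rw [hn]; field_simp
    rw [e]
    calc σ ^ 2 * r * ε / (16 * B' ^ 3 * δ)
        = 1 / 2 * (σ ^ 2 * (r * ε / δ) / (8 * B' ^ 3)) := by field_simp; ring
      _ ≤ _ := by gcongr
  have hψ0 : 0 < ψ := lt_of_lt_of_le (by positivity) hψ1
  have hγψ : γ * ε ≤ c0 * ψ / 2 := by
    calc γ * ε = c0 * (σ ^ 2 * r * ε / (16 * B' ^ 3 * δ)) / 2 := by rw [hγ]; field_simp; norm_num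
      _ ≤ _ := by gcongr
  set x := gordonInner n σ A b g u
  set z := gordonInner n σ A b g v
  set m := gordonInner n σ A b g (fun j => (u j + v j) / 2)
  have hsab := sum_abs_segment_le θ u v (s := 1 / 2) (by norm_num) (by norm_num)
  have e : ∀ j, (1 - 1 / 2 : ℝ) * u j + 1 / 2 * v j + θ j = (u j + v j) / 2 + θ j := fun j => by
    ring
  simp only [e] at hsab
  have hs' := mul_le_mul_of_nonneg_left hsab (show 0 ≤ lam / n by positivity)
  have m1 : gordonCost n σ lam A b θ g u
      ≤ gordonCost n σ lam A b θ g (fun j => (u j + v j) / 2) := hu (Set.mem_univ _)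
  have hcost : gordonCost n σ lam A b θ g (fun j => (u j + v j) / 2)
      ≤ (gordonCost n σ lam A b θ g u + gordonCost n σ lam A b θ g v) / 2 - c0 * ψ / 2 := by
    have h1 : max m 0 = m := max_eq_left (by linarith)
    have h2 : max x 0 = x := max_eq_left (by linarith)
    have h3 : z ≤ max z 0 := le_max_left _ _
    have h4 : m ≤ (x + max z 0) / 2 - ψ := by linarith
    have h5 : m ^ 2 ≤ ((x + max z 0) / 2) ^ 2 - c0 * ψ := by
      have p1 := pow_le_pow_left₀ (by linarith : 0 ≤ m + ψ)
        (by linarith : m + ψ ≤ (x + max z 0) / 2) 2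
      have p2 := mul_le_mul_of_nonneg_right hmidge hψ0.le
      have p3 : (m + ψ) ^ 2 = m ^ 2 + 2 * (m * ψ) + ψ ^ 2 := by ring
      linarith [sq_nonneg ψ]
    unfold gordonCost
    change 1 / 2 * max m 0 ^ 2 + _ ≤ (1 / 2 * max x 0 ^ 2 + _ + (1 / 2 * max z 0 ^ 2 + _)) / 2 - _
    rw [h1, h2]
    have h6 : ((x + max z 0) / 2) ^ 2
        = (x ^ 2 + max z 0 ^ 2) / 2 - (x - max z 0) ^ 2 / 4 := by ring
    have h7 := sq_nonneg (x - max z 0)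
    linarith
  have : 0 < c0 * ψ := by positivity
  linarith [mul_pos hγ0 hε]

end

/-- The per-coordinate squared distance of `z` to `α` times the subdifferential certificate. -/
def certDist (α t x z : ℝ) : ℝ :=
  if t < |x| then (z - α * SignType.sign x) ^ 2 else max (|z| - α) 0 ^ 2

lemma exists_stability_constants {δ σ lmin lmax α t b1 b2 a : ℝ} (hδ : 0 < δ) (hσ : 0 < σ)
    (hlmin : 0 < lmin) (hll : lmin ≤ lmax) (hα : 0 < α) (ht : 0 ≤ t) (hb1 : 0 ≤ b1) (hb : b1 < b2)
    (hb2 : 3 / 4 ≤ b2) (ha : 0 < a) :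
    ∃ M γ : ℝ, 0 < M ∧ 0 < γ ∧ ∀ (N : ℕ) (n lam A b : ℝ) (θ g : Fin N → ℝ),
      0 < N → n = δ * N → lmin ≤ lam → lam ≤ lmax → b2 ≤ A → A ≤ 2 → |b| ≤ σ / 16 →
      ∑ j, g j ^ 2 ≤ 4 * N →
      ∑ j, certDist α t (θ j) (g j) ≤ b1 ^ 2 * n →
      ∑ j, max (|g j| - a) 0 ^ 2 ≤ n / 256 →
      ∑ j, -(clip a (g j) * smallPart M (θ j)) ≤ σ / 16 * n →
      ∀ (ε : ℝ) (u w : Fin N → ℝ), 0 < ε → ε ≤ 1 →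
        IsMinOn (gordonCost n σ lam A b θ g) Set.univ u →
        ε < 1 / (N : ℝ) * ∑ j, (w j - u j) ^ 2 →
        gordonCost n σ lam A b θ g u + γ * ε < gordonCost n σ lam A b θ g w := by
  have hsδ : 0 < Real.sqrt δ := Real.sqrt_pos.2 hδ
  have hlmax : 0 < lmax := by linarith
  have hbb : 0 < b2 - b1 := by linarith
  set B := (2 * α * t / δ + σ + α * (9 * σ ^ 2 / 2) / lmin + lmax / (2 * α)) / (b2 - b1) with hB
  have hB0 : 0 < B := by positivity
  set M := 16 * a * B with hM
  have hM0 : 0 < M := by positivity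
  set Λ := 2 + 2 / Real.sqrt δ with hΛ
  have hΛ0 : 0 < Λ := by positivity
  set κ := min (1 / (16 * a)) (σ / (16 * a * (B + 2 * M / Real.sqrt δ))) with hκ
  have hκ0 : 0 < κ := by positivity
  set c0 := min (σ / 4) (κ * lmin / Λ) with hc0
  have hc00 : 0 < c0 := by positivity
  set r := min 1 (δ * (c0 / Λ) ^ 2) with hr
  have hr0 : 0 < r := by positivity
  refine ⟨2 * M, c0 * σ ^ 2 * r / (32 * (B + 1 / Real.sqrt δ) ^ 3 * δ), by positivity,
    by positivity, ?_⟩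
  intro N n lam A b θ g hN hn hl1 hl2 hA hA2 hbσ hg hcert hg1 hg2 ε u w hε hε1 hu hw
  have hN' : (0 : ℝ) < N := by exact_mod_cast hN
  have hn0 : 0 < n := by rw [hn]; positivity
  have hl : 0 < lam := by linarith
  have hΛg : A + euclNorm g / Real.sqrt n ≤ Λ := by
    have h1 : euclNorm g / Real.sqrt n ≤ 2 / Real.sqrt δ := by
      unfold euclNorm
      rw [hn, Real.sqrt_mul hδ.le]
      have hsN : 0 < Real.sqrt N := Real.sqrt_pos.2 hN'
      have h2 : Real.sqrt (∑ j, g j ^ 2) ≤ 2 * Real.sqrt N := by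
        apply Real.sqrt_le_iff.2
        refine ⟨by positivity, ?_⟩
        rw [mul_pow, Real.sq_sqrt hN'.le]; linarith
      rw [div_le_div_iff₀ (by positivity) hsδ]
      calc _ ≤ 2 * Real.sqrt N * Real.sqrt δ := by gcongr
        _ = _ := by ring
    linarith
  have huB : errScale n σ u ≤ B := by
    refine errScale_le_of_certificate (t := t)
      (v := fun j => if t < |θ j| then (SignType.sign (θ j) : ℝ) else clip α (g j) / α)
      hδ hn hN hσ hα hb1 hb hlmin hl1 hl2 hA hA2 (by linarith) hu ?_ ?_
    · intro j
      split_ifs with h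
      · have h1 : |(SignType.sign (θ j) : ℝ)| ≤ 1 := by
          rcases SignType.sign (θ j) <;> simp
        have h2 : (SignType.sign (θ j) : ℝ) * (u j + θ j) ≤ 1 * |u j + θ j| :=
          (le_abs_self _).trans (by rw [abs_mul]; gcongr)
        have h3 : (SignType.sign (θ j) : ℝ) * θ j = |θ j| := sign_mul_self _
        linarith
      · have h1 : |clip α (g j) / α| ≤ 1 := by
          rw [abs_div, abs_of_pos hα, div_le_one hα]; exact abs_clip_le hα.le _
        have h2 : clip α (g j) / α * (u j + θ j) ≤ 1 * |u j + θ j| :=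
          (le_abs_self _).trans (by rw [abs_mul]; gcongr)
        have h3 : -(clip α (g j) / α * θ j) ≤ 1 * |θ j| :=
          (neg_le_abs _).trans (by rw [abs_mul]; gcongr)
        linarith
    · refine le_trans (le_of_eq (Finset.sum_congr rfl fun j _ => ?_)) hcert
      unfold certDist
      split_ifs with h
      · rfl
      · rw [mul_div_cancel₀ _ hα.ne', sq_sub_clip hα.le]
  have hc : c0 ≤ gordonInner n σ A b g u := by
    refine le_trans ?_ (gordonInner_ge_of_isMinOn (κ := κ) hδ hn hN hσ hl (hb2.trans hA) ha hB0 hM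
      hκ0.le ?_ ?_ hΛg hu huB hbσ hg1 hg2)
    · rw [hc0]; gcongr
    · calc a * κ ≤ a * (1 / (16 * a)) := by gcongr; exact min_le_left _ _
        _ = _ := by field_simp
    · calc a * κ * (B + 2 * M / Real.sqrt δ)
          ≤ a * (σ / (16 * a * (B + 2 * M / Real.sqrt δ))) * (B + 2 * M / Real.sqrt δ) := by
            gcongr; exact min_le_right _ _
        _ = _ := by field_simp
  refine cost_gap_of_gordonInner_ge hδ hn hN hσ hl (by linarith) hB0 hc00 hΛg hr0
    (min_le_left _ _) ?_ rfl hε hε1 hu huB hc hw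
  calc Λ * Real.sqrt (r / δ) ≤ Λ * (c0 / Λ) := by
        gcongr
        apply Real.sqrt_le_iff.2
        refine ⟨by positivity, ?_⟩
        rw [div_le_iff₀ hδ, mul_comm]
        exact min_le_right _ _
    _ = _ := by field_simp

lemma integrable_exp_sq_gaussianReal :
    Integrable (fun z : ℝ => Real.exp ((1 + z ^ 2) / 8)) (gaussianReal 0 1) := by
  rw [gaussianReal_of_var_ne_zero _ one_ne_zero]
  rw [integrable_withDensity_iff_integrable_smul₀' (measurable_gaussianPDF 0 1).aemeasurable
    (by simp [gaussianPDF])]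
  have h := (integrable_exp_neg_mul_sq (b := 3 / 8) (by norm_num)).const_mul
    ((√(2 * Real.pi))⁻¹ * Real.exp (1 / 8))
  refine h.congr (.of_forall fun z => ?_)
  simp only [toReal_gaussianPDF, gaussianPDFReal_def, smul_eq_mul, NNReal.coe_one, mul_one]
  rw [mul_assoc, mul_assoc, ← Real.exp_add, ← Real.exp_add]
  congr 2
  ring

lemma exp_le_one_add_add_sq_mul_exp_abs (y : ℝ) :
    Real.exp y ≤ 1 + y + y ^ 2 * Real.exp |y| := by
  have h1 : 1 ≤ Real.exp |y| := Real.one_le_exp (abs_nonneg y)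
  rcases le_or_gt |y| 1 with h | h
  · have := (abs_le.1 (Real.abs_exp_sub_one_sub_id_le h)).2
    nlinarith [sq_nonneg y]
  · have hy : 1 ≤ y ^ 2 := by rw [← sq_abs]; nlinarith
    rcases lt_abs.1 h with h | h
    · rw [abs_of_pos (by linarith)]
      nlinarith [Real.exp_pos y]
    · have : Real.exp y ≤ 1 := Real.exp_le_one_iff.2 (by linarith)
      nlinarith

lemma integrable_of_abs_le_quadratic {φ : ℝ → ℝ} {K : ℝ} (hφ : Measurable φ)
    (hb : ∀ z, |φ z| ≤ K * (1 + z ^ 2)) : Integrable φ (gaussianReal 0 1) := by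
  refine (integrable_exp_sq_gaussianReal.const_mul (8 * |K|)).mono' hφ.aestronglyMeasurable
    (.of_forall fun z => ?_)
  have := Real.add_one_le_exp ((1 + z ^ 2) / 8)
  calc |φ z| ≤ K * (1 + z ^ 2) := hb z
    _ ≤ |K| * (1 + z ^ 2) := by gcongr; exact le_abs_self K
    _ ≤ |K| * (8 * Real.exp ((1 + z ^ 2) / 8)) := by gcongr; linarith
    _ = _ := by ring

lemma integrable_exp_mul_of_abs_le_quadratic {φ : ℝ → ℝ} {K t : ℝ} (hφ : Measurable φ)
    (hb : ∀ z, |φ z| ≤ K * (1 + z ^ 2)) (ht : 0 ≤ t) (htK : t * K ≤ 1 / 16) :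
    Integrable (fun z => Real.exp (t * φ z)) (gaussianReal 0 1) := by
  refine integrable_exp_sq_gaussianReal.mono' (by fun_prop) (.of_forall fun z => ?_)
  rw [Real.norm_eq_abs, Real.abs_exp]
  apply Real.exp_le_exp.2
  calc t * φ z ≤ t * (K * (1 + z ^ 2)) := by gcongr; exact (le_abs_self _).trans (hb z)
    _ = t * K * (1 + z ^ 2) := by ring
    _ ≤ 1 / 16 * (1 + z ^ 2) := by gcongr
    _ ≤ _ := by nlinarith [sq_nonneg z]

lemma mgf_le_of_abs_le_quadratic {φ : ℝ → ℝ} {K t : ℝ} (hφ : Measurable φ)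
    (hb : ∀ z, |φ z| ≤ K * (1 + z ^ 2)) (ht : 0 ≤ t) (htK : t * K ≤ 1 / 16) :
    ∫ z, Real.exp (t * φ z) ∂gaussianReal 0 1 ≤
      Real.exp (t * ∫ z, φ z ∂gaussianReal 0 1 +
        t ^ 2 * (512 * K ^ 2 * ∫ z, Real.exp ((1 + z ^ 2) / 8) ∂gaussianReal 0 1)) := by
  have hi := integrable_of_abs_le_quadratic hφ hb
  have hpt : ∀ z, Real.exp (t * φ z) ≤
      1 + t * φ z + t ^ 2 * (512 * K ^ 2) * Real.exp ((1 + z ^ 2) / 8) := by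
    intro z
    have h0 : |t * φ z| ≤ t * K * (1 + z ^ 2) := by
      rw [abs_mul, abs_of_nonneg ht, mul_assoc]; gcongr; exact hb z
    have h1 : |t * φ z| ≤ (1 + z ^ 2) / 16 :=
      h0.trans (by nlinarith [sq_nonneg z])
    have h2 : (1 + z ^ 2) ^ 2 ≤ 512 * Real.exp ((1 + z ^ 2) / 16) := by
      have := Real.quadratic_le_exp_of_nonneg (x := (1 + z ^ 2) / 16) (by positivity)
      nlinarith [sq_nonneg z]
    have h3 : Real.exp ((1 + z ^ 2) / 8) =
        Real.exp ((1 + z ^ 2) / 16) * Real.exp ((1 + z ^ 2) / 16) := by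
      rw [← Real.exp_add]; ring_nf
    refine (exp_le_one_add_add_sq_mul_exp_abs _).trans ?_
    refine add_le_add_right ?_ _
    calc (t * φ z) ^ 2 * Real.exp |t * φ z|
        ≤ (t * K * (1 + z ^ 2)) ^ 2 * Real.exp ((1 + z ^ 2) / 16) := by
          rw [← sq_abs (t * φ z)]; gcongr
      _ = t ^ 2 * K ^ 2 * ((1 + z ^ 2) ^ 2 * Real.exp ((1 + z ^ 2) / 16)) := by ring
      _ ≤ t ^ 2 * K ^ 2 * (512 * Real.exp ((1 + z ^ 2) / 16) * Real.exp ((1 + z ^ 2) / 16)) := by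
          gcongr
      _ = t ^ 2 * (512 * K ^ 2) * Real.exp ((1 + z ^ 2) / 8) := by rw [h3]; ring
  have h1 : Integrable (fun z => 1 + t * φ z) (gaussianReal 0 1) :=
    (integrable_const _).add (hi.const_mul t)
  have h2 := integrable_exp_sq_gaussianReal.const_mul (t ^ 2 * (512 * K ^ 2))
  refine (integral_mono (integrable_exp_mul_of_abs_le_quadratic hφ hb ht htK) (h1.add h2)
    hpt).trans ?_
  have h3 : ∫ z, (1 + t * φ z +
      t ^ 2 * (512 * K ^ 2) * Real.exp ((1 + z ^ 2) / 8)) ∂gaussianReal 0 1 =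
      1 + t * ∫ z, φ z ∂gaussianReal 0 1 +
        t ^ 2 * (512 * K ^ 2) * ∫ z, Real.exp ((1 + z ^ 2) / 8) ∂gaussianReal 0 1 := by
    rw [integral_add h1 h2, integral_add (integrable_const _) (hi.const_mul t),
      integral_const_mul, integral_const_mul]
    simp
  refine h3.le.trans ?_
  have := Real.add_one_le_exp (t * ∫ z, φ z ∂gaussianReal 0 1 +
        t ^ 2 * (512 * K ^ 2 * ∫ z, Real.exp ((1 + z ^ 2) / 8) ∂gaussianReal 0 1))
  linarith

/-- Chernoff bound for sums of independent functions of Gaussians with at most quadratic growth,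
uniform over the functions. -/
lemma exists_gaussian_concentration {K η : ℝ} (hK : 0 < K) (hη : 0 < η) :
    ∃ c : ℝ, 0 < c ∧ ∀ (k : ℕ) (φ : Fin k → ℝ → ℝ) (m : ℝ),
      (∀ i, Measurable (φ i)) → (∀ i z, |φ i z| ≤ K * (1 + z ^ 2)) →
      ∑ i, ∫ z, φ i z ∂gaussianReal 0 1 ≤ m →
      Measure.pi (fun _ : Fin k => gaussianReal 0 1) {g | m + η * k ≤ ∑ i, φ i (g i)} ≤
        ENNReal.ofReal (Real.exp (-c * k)) := by
  set C := 512 * K ^ 2 * ∫ z, Real.exp ((1 + z ^ 2) / 8) ∂gaussianReal 0 1 with hC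
  have hI : 0 < ∫ z : ℝ, Real.exp ((1 + z ^ 2) / 8) ∂gaussianReal 0 1 :=
    integral_exp_pos integrable_exp_sq_gaussianReal
  have hC0 : 0 < C := by positivity
  set t := min (1 / (16 * K)) (η / (2 * C)) with ht
  have ht0 : 0 < t := by positivity
  have htK : t * K ≤ 1 / 16 := by
    calc t * K ≤ 1 / (16 * K) * K := by gcongr; exact min_le_left _ _
      _ = 1 / 16 := by field_simp
  have htC : t * C ≤ η / 2 := by
    calc t * C ≤ η / (2 * C) * C := by gcongr; exact min_le_right _ _
      _ = η / 2 := by field_simp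
  refine ⟨t * (η / 2), by positivity, fun k φ m hφ hb hm => ?_⟩
  have hmgf : mgf (fun g : Fin k → ℝ => ∑ i, φ i (g i))
      (Measure.pi fun _ : Fin k => gaussianReal 0 1) t ≤ Real.exp (t * m + k * (t ^ 2 * C)) := by
    have h1 : ∀ g : Fin k → ℝ, Real.exp (t * ∑ i, φ i (g i)) =
        ∏ i, Real.exp (t * φ i (g i)) := fun g => by rw [Finset.mul_sum, Real.exp_sum]
    simp only [mgf, h1]
    rw [integral_fintype_prod_eq_prod (fun i z => Real.exp (t * φ i z))]
    calc _ ≤ ∏ i : Fin k, Real.exp (t * ∫ z, φ i z ∂gaussianReal 0 1 + t ^ 2 * C) :=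
          Finset.prod_le_prod (fun i _ => integral_nonneg fun z => (Real.exp_pos _).le)
            fun i _ => mgf_le_of_abs_le_quadratic (hφ i) (hb i) ht0.le htK
      _ = Real.exp (t * ∑ i, ∫ z, φ i z ∂gaussianReal 0 1 + k * (t ^ 2 * C)) := by
          rw [← Real.exp_sum, Finset.sum_add_distrib, Finset.mul_sum]; simp
      _ ≤ _ := by gcongr
  have hint : Integrable (fun g : Fin k → ℝ => Real.exp (t * ∑ i, φ i (g i)))
      (Measure.pi fun _ : Fin k => gaussianReal 0 1) := by
    have h1 : ∀ g : Fin k → ℝ, Real.exp (t * ∑ i, φ i (g i)) =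
        ∏ i, Real.exp (t * φ i (g i)) := fun g => by rw [Finset.mul_sum, Real.exp_sum]
    simp only [h1]
    exact Integrable.fintype_prod_dep
      fun i => integrable_exp_mul_of_abs_le_quadratic (hφ i) (hb i) ht0.le htK
  have h := measure_ge_le_exp_mul_mgf (m + η * k) ht0.le hint
  rw [← ENNReal.ofReal_toReal (measure_ne_top (Measure.pi fun _ : Fin k => gaussianReal 0 1) _)]
  apply ENNReal.ofReal_le_ofReal
  refine h.trans ?_
  calc _ ≤ Real.exp (-t * (m + η * k)) * Real.exp (t * m + k * (t ^ 2 * C)) := by gcongr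
    _ = Real.exp (-(t * k) * (η - t * C)) := by rw [← Real.exp_add]; ring_nf
    _ ≤ _ := by
      apply Real.exp_le_exp.2
      have : t * k * (η / 2) ≤ t * k * (η - t * C) := by gcongr; linarith
      linarith

lemma gaussianPDFReal_eq_gphi (x : ℝ) : gaussianPDFReal 0 1 x = gphi x := by
  simp only [gaussianPDFReal_def, gphi, NNReal.coe_one, mul_one, sub_zero]
  ring

lemma integral_gaussianReal_eq_integral_gphi (f : ℝ → ℝ) :
    ∫ z, f z ∂gaussianReal 0 1 = ∫ z, gphi z * f z := by
  simp [integral_gaussianReal_eq_integral_smul one_ne_zero, gaussianPDFReal_eq_gphi]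

lemma integrable_gphi_mul {φ : ℝ → ℝ} {K : ℝ} (hφ : Measurable φ)
    (hb : ∀ z, |φ z| ≤ K * (1 + z ^ 2)) : Integrable (fun z => gphi z * φ z) := by
  have h := integrable_of_abs_le_quadratic hφ hb
  rw [gaussianReal_of_var_ne_zero _ one_ne_zero,
    integrable_withDensity_iff_integrable_smul₀' (measurable_gaussianPDF 0 1).aemeasurable
    (by simp [gaussianPDF])] at h
  simpa [toReal_gaussianPDF, gaussianPDFReal_eq_gphi] using h

lemma abs_max_abs_sub_sq_le {a : ℝ} (ha : 0 ≤ a) (z : ℝ) :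
    |max (|z| - a) 0 ^ 2| ≤ 1 * (1 + z ^ 2) := by
  rw [abs_of_nonneg (by positivity)]
  have h1 : max (|z| - a) 0 ≤ |z| := max_le (by linarith) (abs_nonneg z)
  have h2 : max (|z| - a) 0 ^ 2 ≤ |z| ^ 2 := by gcongr
  rw [sq_abs] at h2
  linarith

lemma integral_sq_gaussianReal : ∫ z : ℝ, z ^ 2 ∂gaussianReal 0 1 = 1 := by
  have h := variance_fun_id_gaussianReal (μ := 0) (v := 1)
  rw [variance_of_integral_eq_zero (by fun_prop) (integral_id_gaussianReal)] at h
  simpa using h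

lemma integral_comp_neg_gaussianReal (f : ℝ → ℝ) :
    ∫ z, f (-z) ∂gaussianReal 0 1 = ∫ z, f z ∂gaussianReal 0 1 := by
  have h := gaussianReal_map_neg (μ := 0) (v := 1)
  rw [neg_zero] at h
  conv_rhs => rw [← h]
  exact ((MeasurableEquiv.neg ℝ).measurableEmbedding.integral_map f).symm

lemma clip_neg (a x : ℝ) : clip a (-x) = -clip a x ∨ a < 0 := by
  by_cases ha : a < 0
  · exact Or.inr ha
  · left
    simp only [clip]
    rcases le_total x a with h1 | h1 <;> rcases le_total (-a) x with h2 | h2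
    all_goals
      simp only [min_def, max_def]
      split_ifs <;> linarith

lemma integral_clip_gaussianReal {a : ℝ} (ha : 0 ≤ a) :
    ∫ z, clip a z ∂gaussianReal 0 1 = 0 := by
  have h := integral_comp_neg_gaussianReal (clip a)
  have h2 : ∀ z, clip a (-z) = -clip a z := fun z =>
    (clip_neg a z).resolve_right (by linarith)
  simp only [h2, integral_neg] at h
  linarith

lemma exists_integral_tail_le {e : ℝ} (he : 0 < e) :
    ∃ a : ℝ, 0 < a ∧ ∫ z : ℝ, max (|z| - a) 0 ^ 2 ∂gaussianReal 0 1 ≤ e := by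
  set I := ∫ z : ℝ, Real.exp ((1 + z ^ 2) / 8) ∂gaussianReal 0 1
  have hI : 0 < I := integral_exp_pos integrable_exp_sq_gaussianReal
  refine ⟨√(128 * I / e), by positivity, ?_⟩
  set a := √(128 * I / e) with ha
  have ha0 : 0 < a := by positivity
  have ha2 : a ^ 2 = 128 * I / e := Real.sq_sqrt (by positivity)
  have h : ∀ z : ℝ, max (|z| - a) 0 ^ 2 ≤ 128 / a ^ 2 * Real.exp ((1 + z ^ 2) / 8) := by
    intro z
    rw [div_mul_eq_mul_div, le_div_iff₀ (by positivity)]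
    have h1 : max (|z| - a) 0 * a ≤ z ^ 2 := by
      rw [← sq_abs z]
      rcases le_total (|z|) a with h | h
      · rw [max_eq_right (by linarith)]; nlinarith
      · rw [max_eq_left (by linarith)]; nlinarith [abs_nonneg z]
    have h2 : (z ^ 2) ^ 2 ≤ 128 * Real.exp ((1 + z ^ 2) / 8) := by
      have := Real.quadratic_le_exp_of_nonneg (x := (1 + z ^ 2) / 8) (by positivity)
      nlinarith [sq_nonneg z]
    calc max (|z| - a) 0 ^ 2 * a ^ 2 = (max (|z| - a) 0 * a) ^ 2 := by ring
      _ ≤ (z ^ 2) ^ 2 := by gcongr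
      _ ≤ _ := h2
  refine (integral_mono (integrable_of_abs_le_quadratic (by fun_prop)
    (abs_max_abs_sub_sq_le ha0.le)) (integrable_exp_sq_gaussianReal.const_mul _) h).trans ?_
  rw [integral_const_mul, ha2]
  apply le_of_eq
  change 128 / (128 * I / e) * I = e
  field_simp

lemma integral_sub_sq_gaussianReal (m : ℝ) :
    ∫ z : ℝ, (z - m) ^ 2 ∂gaussianReal 0 1 = 1 + m ^ 2 := by
  have h1 : Integrable (fun z : ℝ => z ^ 2) (gaussianReal 0 1) :=
    integrable_of_abs_le_quadratic (K := 1) (by fun_prop)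
      fun z => by rw [abs_of_nonneg (by positivity)]; linarith
  have h2 : Integrable (fun z : ℝ => z) (gaussianReal 0 1) :=
    integrable_of_abs_le_quadratic (K := 1) (by fun_prop)
      fun z => by nlinarith [sq_abs z, sq_nonneg (|z| - 1)]
  have h3 : ∀ z : ℝ, (z - m) ^ 2 = z ^ 2 - 2 * m * z + m ^ 2 := fun z => by ring
  simp only [h3]
  have h4 : Integrable (fun z : ℝ => z ^ 2 - 2 * m * z) (gaussianReal 0 1) :=
    h1.sub (h2.const_mul _)
  rw [integral_add h4 (integrable_const _), integral_sub h1 (h2.const_mul _), integral_const_mul, integral_sq_gaussianReal,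
    integral_id_gaussianReal]
  simp

lemma integral_tail_le_one_add_sq {α : ℝ} (hα : 0 ≤ α) :
    ∫ z : ℝ, max (|z| - α) 0 ^ 2 ∂gaussianReal 0 1 ≤ 1 + α ^ 2 := by
  have h1 : ∫ z : ℝ, z ^ 2 ∂gaussianReal 0 1 = 1 := integral_sq_gaussianReal
  have h : ∫ z : ℝ, max (|z| - α) 0 ^ 2 ∂gaussianReal 0 1 ≤ ∫ z : ℝ, z ^ 2 ∂gaussianReal 0 1 := by
    refine integral_mono (integrable_of_abs_le_quadratic (by fun_prop) (abs_max_abs_sub_sq_le hα))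
      (integrable_of_abs_le_quadratic (K := 1) (by fun_prop) fun z => ?_) fun z => ?_
    · rw [abs_of_nonneg (by positivity)]; linarith
    · rw [← sq_abs z]
      exact pow_le_pow_left₀ (le_max_right _ _) (max_le (by linarith) (abs_nonneg z)) 2
  nlinarith [sq_nonneg α]

lemma integral_tail_eq {α : ℝ} (hα : 0 ≤ α) :
    ∫ z : ℝ, max (|z| - α) 0 ^ 2 ∂gaussianReal 0 1 =
      2 * ((1 + α ^ 2) * gPhi (-α) - α * gphi α) := by
  have hder : ∀ x : ℝ, HasDerivAt gphi (-x * gphi x) x := by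
    intro x
    have h1 : HasDerivAt (fun x : ℝ => -x ^ 2 / 2) (-x) x := by
      refine ((hasDerivAt_pow 2 x).fun_neg.div_const 2).congr_deriv ?_
      norm_num
      ring
    exact ((h1.exp).div_const (√(2 * Real.pi))).congr_deriv (by rw [gphi]; ring)
  have hq : ∀ p q r : ℝ, Integrable (fun z : ℝ => gphi z * (p * z ^ 2 + q * z + r)) := by
    intro p q r
    refine integrable_gphi_mul (K := |p| + |q| + |r|) (by fun_prop) fun z => ?_
    have h1 : |p * z ^ 2 + q * z + r| ≤ |p| * z ^ 2 + |q| * |z| + |r| := by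
      refine (abs_add_le _ _).trans (add_le_add_left ((abs_add_le _ _).trans ?_) _)
      rw [abs_mul, abs_mul, abs_of_nonneg (sq_nonneg z)]
    have h2 : |z| ≤ 1 + z ^ 2 := by nlinarith [sq_abs z, sq_nonneg (|z| - 1)]
    have h3 : |q| * |z| ≤ |q| * (1 + z ^ 2) := by gcongr
    nlinarith [abs_nonneg p, abs_nonneg r, mul_nonneg (abs_nonneg r) (sq_nonneg z)]
  rw [integral_gaussianReal_eq_integral_gphi]
  have e1 : ∫ z, gphi z * max (|z| - α) 0 ^ 2 =
      ∫ z, (fun y => gphi y * max (y - α) 0 ^ 2) |z| := by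
    congr 1; ext z; simp [gphi]
  rw [e1, integral_comp_abs (f := fun y => gphi y * max (y - α) 0 ^ 2)]
  have e2 : ∫ z in Set.Ioi 0, gphi z * max (z - α) 0 ^ 2 =
      ∫ z in Set.Ioi α, gphi z * max (z - α) 0 ^ 2 := by
    refine setIntegral_eq_of_subset_of_forall_sdiff_eq_zero measurableSet_Ioi
      (Set.Ioi_subset_Ioi hα) fun z hz => ?_
    have h : z ≤ α := not_lt.1 hz.2
    rw [max_eq_right (by linarith)]; simp
  have e3 : ∫ z in Set.Ioi α, gphi z * max (z - α) 0 ^ 2 =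
      ∫ z in Set.Ioi α, (gphi z * (1 * z ^ 2 + (-2 * α) * z + (-1)) +
        gphi z * (0 * z ^ 2 + 0 * z + (1 + α ^ 2))) := by
    refine setIntegral_congr_fun measurableSet_Ioi fun z hz => ?_
    have : α < z := hz
    rw [max_eq_left (by linarith)]; ring
  have e4 : ∫ z in Set.Ioi α, gphi z * (1 * z ^ 2 + (-2 * α) * z + (-1)) =
      0 - gphi α * (0 * α ^ 2 + (-1) * α + 2 * α) := by
    have hd : ∀ x : ℝ, HasDerivAt (fun z => gphi z * (0 * z ^ 2 + (-1) * z + 2 * α))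
        (gphi x * (1 * x ^ 2 + (-2 * α) * x + (-1))) x := by
      intro x
      have h1 : HasDerivAt (fun z : ℝ => 0 * z ^ 2 + (-1) * z + 2 * α) (-1) x := by
        have h := ((hasDerivAt_id' x).const_mul (-1)).add_const (2 * α)
        simpa only [zero_mul, zero_add, mul_one] using h
      exact ((hder x).fun_mul h1).congr_deriv (by ring)
    refine integral_Ioi_of_hasDerivAt_of_tendsto (hd α).continuousAt.continuousWithinAt
      (fun x _ => hd x) (hq _ _ _).integrableOn ?_
    exact tendsto_zero_of_hasDerivAt_of_integrableOn_Ioi (a := α) (fun x _ => hd x)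
      (hq _ _ _).integrableOn (hq _ _ _).integrableOn
  have e5 : ∫ z in Set.Ioi α, gphi z * (0 * z ^ 2 + 0 * z + (1 + α ^ 2)) =
      gPhi (-α) * (1 + α ^ 2) := by
    have h := integral_comp_neg_Iic (-α) gphi
    rw [neg_neg] at h
    simp only [zero_mul, zero_add]
    rw [integral_mul_const, ← h, gPhi]
    simp [gphi]
  rw [e2, e3, integral_add (hq _ _ _).integrableOn (hq _ _ _).integrableOn, e4, e5]
  ring

lemma measurable_certDist (α t x : ℝ) : Measurable (certDist α t x) := by
  unfold certDist
  split_ifs <;> fun_prop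

lemma abs_certDist_le {α : ℝ} (hα : 0 ≤ α) (t x z : ℝ) :
    |certDist α t x z| ≤ (2 + 2 * α ^ 2) * (1 + z ^ 2) := by
  have h0 : 0 ≤ α ^ 2 * z ^ 2 := by positivity
  unfold certDist
  split_ifs
  · rw [abs_of_nonneg (by positivity)]
    have h : (SignType.sign x : ℝ) ^ 2 ≤ 1 := by
      rcases SignType.sign x <;> simp
    have h1 : (α * (SignType.sign x : ℝ)) ^ 2 ≤ α ^ 2 := by
      rw [mul_pow]; nlinarith [sq_nonneg α]
    nlinarith [sq_nonneg (z + α * (SignType.sign x : ℝ)), sq_nonneg z]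
  · refine (abs_max_abs_sub_sq_le hα z).trans ?_
    nlinarith [sq_nonneg α, sq_nonneg z]

lemma integral_certDist {α : ℝ} {t : ℝ} (ht : 0 ≤ t) (x : ℝ) :
    ∫ z, certDist α t x z ∂gaussianReal 0 1 =
      if t < |x| then 1 + α ^ 2 else ∫ z : ℝ, max (|z| - α) 0 ^ 2 ∂gaussianReal 0 1 := by
  unfold certDist
  split_ifs with h
  · rw [integral_sub_sq_gaussianReal, mul_pow]
    have hx : x ≠ 0 := fun h0 => by rw [h0, abs_zero] at h; linarith
    have : (SignType.sign x : ℝ) ^ 2 = 1 := by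
      rcases lt_or_gt_of_ne hx with h | h
      · simp [sign_neg h]
      · simp [sign_pos h]
    rw [this, mul_one]
  · rfl

lemma sum_integral_certDist_le {α t s : ℝ} (hα : 0 ≤ α) (ht : 0 ≤ t) {N : ℕ} (θ : Fin N → ℝ)
    (hs : ((Finset.univ.filter fun i => t < |θ i|).card : ℝ) ≤ s * N) :
    ∑ j, ∫ z, certDist α t (θ j) z ∂gaussianReal 0 1 ≤
      N * (∫ z : ℝ, max (|z| - α) 0 ^ 2 ∂gaussianReal 0 1 +
        s * (1 + α ^ 2 - ∫ z : ℝ, max (|z| - α) 0 ^ 2 ∂gaussianReal 0 1)) := by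
  have hG := integral_tail_le_one_add_sq hα
  set G := ∫ z : ℝ, max (|z| - α) 0 ^ 2 ∂gaussianReal 0 1 with hGdef
  have h1 : ∀ j, ∫ z, certDist α t (θ j) z ∂gaussianReal 0 1 =
      G + if t < |θ j| then 1 + α ^ 2 - G else 0 := by
    intro j
    rw [integral_certDist ht]
    split_ifs <;> ring
  simp only [h1, Finset.sum_add_distrib, ← Finset.sum_filter, Finset.sum_const, nsmul_eq_mul,
    Finset.card_univ, Fintype.card_fin]
  have := mul_le_mul_of_nonneg_right hs (sub_nonneg.2 hG)
  linarith

lemma card_filter_le_of_mem_Fball {N : ℕ} (hN : 0 < N) {p ξ s : ℝ} (hp : 0 < p) (hξ : 0 < ξ)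
    (hs : 0 < s) {θ : Fin N → ℝ} (hθ : θ ∈ Fball N p ξ) :
    ((Finset.univ.filter fun i => ξ * s ^ (-1 / p) < |θ i|).card : ℝ) ≤ s * N := by
  have hN' : (0 : ℝ) < N := by exact_mod_cast hN
  have h1 : ∑ i, |θ i| ^ p ≤ N * ξ ^ p := by
    have h : 1 / (N : ℝ) * ∑ i, |θ i| ^ p ≤ ξ ^ p := hθ
    rwa [one_div_mul_eq_div, div_le_iff₀ hN', mul_comm] at h
  set F := Finset.univ.filter fun i => ξ * s ^ (-1 / p) < |θ i|
  have hpow : (ξ * s ^ (-1 / p)) ^ p = ξ ^ p * s⁻¹ := by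
    rw [Real.mul_rpow hξ.le (by positivity), ← Real.rpow_mul hs.le,
      div_mul_cancel₀ _ hp.ne', Real.rpow_neg_one]
  have h2 : F.card * (ξ ^ p * s⁻¹) ≤ ∑ i, |θ i| ^ p := by
    calc (F.card : ℝ) * (ξ ^ p * s⁻¹) = ∑ i ∈ F, ξ ^ p * s⁻¹ := by simp
      _ ≤ ∑ i ∈ F, |θ i| ^ p := by
        refine Finset.sum_le_sum fun i hi => ?_
        rw [← hpow]
        exact Real.rpow_le_rpow (by positivity) (Finset.mem_filter.1 hi).2.le hp.le
      _ ≤ _ := Finset.sum_le_univ_sum_of_nonneg fun i => by positivity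
  have h3 : 0 < ξ ^ p := by positivity
  have h4 : F.card * (ξ ^ p * s⁻¹) ≤ N * ξ ^ p := h2.trans h1
  have h5 : (F.card : ℝ) = F.card * (ξ ^ p * s⁻¹) * (s / ξ ^ p) := by field_simp
  rw [h5]
  calc _ ≤ N * ξ ^ p * (s / ξ ^ p) := by gcongr
    _ = s * N := by field_simp

/-- Uniformly over the class, some certificate has mean squared distance below `δ`. -/
lemma exists_certDist_bound {δ q : ℝ} (hδ : 0 < δ) {Dfam : (M : ℕ) → Set (Fin M → ℝ)}
    (hD : DFamSpec δ Dfam q) :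
    ∃ α t m : ℝ, 0 < α ∧ 0 ≤ t ∧ m < δ ∧ ∀ (N : ℕ), 0 < N → ∀ θ ∈ Dfam N,
      ∑ j, ∫ z, certDist α t (θ j) z ∂gaussianReal 0 1 ≤ N * m := by
  rcases hD with ⟨p, ξ, hp, hξ, hD, -⟩ | ⟨s, hs, hsmax, hD, -⟩
  · obtain ⟨α, hα, hG⟩ := exists_integral_tail_le (e := δ / 2) (by positivity)
    have hG0 : 0 ≤ ∫ z : ℝ, max (|z| - α) 0 ^ 2 ∂gaussianReal 0 1 :=
      integral_nonneg fun z => by positivity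
    set s := δ / (4 * (1 + α ^ 2)) with hs
    have hs0 : 0 < s := by positivity
    refine ⟨α, ξ * s ^ (-1 / p), _, hα, by positivity, ?_, fun N hN θ hθ =>
      sum_integral_certDist_le hα.le (by positivity) θ
        (card_filter_le_of_mem_Fball hN hp hξ hs0 (hD N ▸ hθ))⟩
    have h1 : s * (1 + α ^ 2) = δ / 4 := by rw [hs]; field_simp
    nlinarith [mul_nonneg hs0.le hG0]
  · have h1 : s / δ < sSup ((fun α : ℝ =>
      (1 - (2 / δ) * ((1 + α ^ 2) * gPhi (-α) - α * gphi α)) /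
      (1 + α ^ 2 - 2 * ((1 + α ^ 2) * gPhi (-α) - α * gphi α))) '' Set.Ici 0) := by
      rw [div_lt_iff₀' hδ]; exact hsmax
    obtain ⟨_, ⟨α, hα, rfl⟩, hlt⟩ := exists_lt_of_lt_csSup (Set.nonempty_Ici.image _) h1
    have hα0 : 0 ≤ α := hα
    have hG := integral_tail_le_one_add_sq hα0
    have hG2 := integral_tail_eq hα0
    set G := ∫ z : ℝ, max (|z| - α) 0 ^ 2 ∂gaussianReal 0 1 with hGdef
    have hnum : 1 - 2 / δ * ((1 + α ^ 2) * gPhi (-α) - α * gphi α) = (δ - G) / δ := by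
      rw [hG2]; field_simp
    simp only [hnum, ← hG2] at hlt
    have hden0 : 1 + α ^ 2 - G ≠ 0 := by
      intro h
      rw [h, div_zero] at hlt
      have : 0 ≤ s / δ := by positivity
      linarith
    have hden : 0 < 1 + α ^ 2 - G := lt_of_le_of_ne (by linarith) hden0.symm
    have hαpos : 0 < α := by
      rcases hα0.lt_or_eq with h | h
      · exact h
      · exfalso
        apply hden0
        rw [hGdef, ← h]
        simp [integral_sq_gaussianReal]
    refine ⟨α, 0, _, hαpos, le_rfl, ?_, fun N hN θ hθ =>
      sum_integral_certDist_le (s := s) hα0 le_rfl θ ?_⟩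
    · rw [lt_div_iff₀ hden, div_mul_eq_mul_div, div_lt_div_iff_of_pos_right hδ] at hlt
      linarith
    · have : (l0 θ : ℝ) ≤ s * N := by rw [hD N] at hθ; exact hθ
      simpa [l0, abs_pos] using this

lemma abs_smallPart_le {M : ℝ} (hM : 0 ≤ M) (x : ℝ) : |smallPart M x| ≤ M := by
  unfold smallPart
  split_ifs with h
  · exact h
  · simpa using hM

lemma gordonL_eq_gordonCost {n N : ℕ} (σ lam : ℝ) (θ g : Fin N → ℝ) (h : Fin n → ℝ) (g' : ℝ) :
    gordonL n N σ lam θ g h g' =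
      gordonCost n σ lam (√(∑ i, h i ^ 2) / √n) (g' * σ / √n) θ g := by
  ext w
  simp only [gordonL, gordonCost, gordonInner, errScale, mul_div_assoc]

lemma gaussianReal_sq_tail_le (n : ℕ) :
    gaussianReal 0 1 {z : ℝ | (n : ℝ) / 256 < z ^ 2} ≤
      ENNReal.ofReal ((∫ z : ℝ, Real.exp ((1 + z ^ 2) / 8) ∂gaussianReal 0 1) *
        Real.exp (-(1 / 2048) * n)) := by
  have h := mul_meas_ge_le_integral_of_nonneg (μ := gaussianReal 0 1)
    (f := fun z : ℝ => Real.exp ((1 + z ^ 2) / 8)) (.of_forall fun z => (Real.exp_pos _).le)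
    integrable_exp_sq_gaussianReal (Real.exp (1 / 2048 * n))
  have h1 : (gaussianReal 0 1).real {z : ℝ | (n : ℝ) / 256 < z ^ 2} ≤
      (gaussianReal 0 1).real
        {z : ℝ | Real.exp (1 / 2048 * n) ≤ Real.exp ((1 + z ^ 2) / 8)} := by
    refine measureReal_mono fun z hz => Real.exp_le_exp.2 ?_
    have : (n : ℝ) / 256 < z ^ 2 := hz
    linarith
  rw [← ENNReal.ofReal_toReal (measure_ne_top (gaussianReal 0 1) _)]
  apply ENNReal.ofReal_le_ofReal
  rw [neg_mul, Real.exp_neg, ← div_eq_mul_inv, le_div_iff₀ (Real.exp_pos _), mul_comm]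
  exact (mul_le_mul_of_nonneg_left h1 (Real.exp_pos _).le).trans h

lemma Pgordon_le_add {n N : ℕ} {S : Set ((Fin N → ℝ) × ((Fin n → ℝ) × ℝ))} {G : Set (Fin N → ℝ)}
    {H : Set (Fin n → ℝ)} {Z : Set ℝ}
    (hS : ∀ ω ∈ S, ω.1 ∈ G ∨ ω.2.1 ∈ H ∨ ω.2.2 ∈ Z) :
    Pgordon n N S ≤ Measure.pi (fun _ : Fin N => gaussianReal 0 1) G +
      (Measure.pi (fun _ : Fin n => gaussianReal 0 1) H + gaussianReal 0 1 Z) := by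
  have hsub : S ⊆ G ×ˢ Set.univ ∪ (Set.univ ×ˢ (H ×ˢ Set.univ) ∪
      Set.univ ×ˢ (Set.univ ×ˢ Z)) := by
    intro ω hω
    rcases hS ω hω with h | h | h
    · exact Or.inl ⟨h, trivial⟩
    · exact Or.inr (Or.inl ⟨trivial, h, trivial⟩)
    · exact Or.inr (Or.inr ⟨trivial, trivial, h⟩)
  refine (measure_mono hsub).trans ((measure_union_le _ _).trans ?_)
  refine add_le_add ?_ ((measure_union_le _ _).trans (add_le_add ?_ ?_)) <;>
    simp [Pgordon, Measure.prod_prod]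

lemma Pgordon_ae_sum_sq_pos {n N : ℕ} (hn : 0 < n) :
    ∀ᵐ ω ∂(Pgordon n N), 0 < ∑ i, ω.2.1 i ^ 2 := by
  have : NullSingletonClass (gaussianReal 0 1) := nullSingletonClass_gaussianReal one_ne_zero
  have h0 : Measure.pi (fun _ : Fin n => gaussianReal 0 1) {h | h ⟨0, hn⟩ = 0} = 0 := by
    have := (measurePreserving_eval (fun _ : Fin n => gaussianReal 0 1) ⟨0, hn⟩).measure_preimage
      (measurableSet_singleton (0 : ℝ)).nullMeasurableSet
    rw [measure_singleton] at this
    exact this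
  rw [ae_iff]
  refine le_antisymm ((Pgordon_le_add (G := ∅) (H := {h | h ⟨0, hn⟩ = 0}) (Z := ∅)
    fun ω hω => Or.inr (Or.inl ?_)).trans ?_) zero_le
  · by_contra hne
    have hne' : ω.2.1 ⟨0, hn⟩ ≠ 0 := hne
    refine hω ?_
    have : 0 < ω.2.1 ⟨0, hn⟩ ^ 2 := by positivity
    exact this.trans_le (Finset.single_le_sum (f := fun i => ω.2.1 i ^ 2)
      (fun i _ => sq_nonneg _) (Finset.mem_univ _))
  · simp [h0]

/-- High-probability bounds on the events controlling the stability of Gordon's cost. -/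
lemma exists_gaussian_event_bounds {δ σ α t m a M b1 b2 : ℝ} (hδ : 0 < δ) (hσ : 0 < σ)
    (hα : 0 < α) (hm : m < b1 ^ 2 * δ) (ha : 0 < a)
    (hatail : ∫ z : ℝ, max (|z| - a) 0 ^ 2 ∂gaussianReal 0 1 ≤ δ / 512) (hM : 0 < M)
    (hb2 : b2 ^ 2 < 1) :
    ∃ c : ℝ, 0 < c ∧ ∀ (N n : ℕ) (θ : Fin N → ℝ), (n : ℝ) = δ * N →
      ∑ j, ∫ z, certDist α t (θ j) z ∂gaussianReal 0 1 ≤ N * m →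
      Measure.pi (fun _ : Fin N => gaussianReal 0 1)
        {g | ¬ (∑ j, g j ^ 2 ≤ 4 * N ∧ ∑ j, certDist α t (θ j) (g j) ≤ b1 ^ 2 * n ∧
          ∑ j, max (|g j| - a) 0 ^ 2 ≤ (n : ℝ) / 256 ∧
          ∑ j, -(clip a (g j) * smallPart M (θ j)) ≤ σ / 16 * n)} ≤
        ENNReal.ofReal (4 * Real.exp (-c * n)) ∧
      Measure.pi (fun _ : Fin n => gaussianReal 0 1)
        {h | ¬ (b2 ^ 2 * n ≤ ∑ i, h i ^ 2 ∧ ∑ i, h i ^ 2 ≤ 4 * n)} ≤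
        ENNReal.ofReal (2 * Real.exp (-c * n)) := by
  obtain ⟨c1, hc1, H1⟩ := exists_gaussian_concentration (K := 1) (η := 3) one_pos (by norm_num)
  obtain ⟨c2, hc2, H2⟩ := exists_gaussian_concentration (K := 1) (η := 1 - b2 ^ 2) one_pos
    (by linarith)
  obtain ⟨c3, hc3, H3⟩ := exists_gaussian_concentration (K := 2 + 2 * α ^ 2)
    (η := b1 ^ 2 * δ - m) (by positivity) (by linarith)
  obtain ⟨c4, hc4, H4⟩ := exists_gaussian_concentration (K := 1) (η := δ / 512) one_pos
    (by positivity)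
  obtain ⟨c5, hc5, H5⟩ := exists_gaussian_concentration (K := a * M) (η := σ / 16 * δ)
    (by positivity) (by positivity)
  obtain ⟨c, hc, h1, h1', h2, h3, h4, h5⟩ : ∃ c : ℝ, 0 < c ∧ c ≤ c1 / δ ∧ c ≤ c1 ∧ c ≤ c2 ∧
      c ≤ c3 / δ ∧ c ≤ c4 / δ ∧ c ≤ c5 / δ :=
    ⟨min (c1 / δ) (min c1 (min c2 (min (c3 / δ) (min (c4 / δ) (c5 / δ))))), by positivity,
      by simp, by simp, by simp, by simp, by simp, by simp⟩
  refine ⟨c, hc, fun N n θ hn hθ => ?_⟩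
  have hN0 : (0 : ℝ) ≤ N := Nat.cast_nonneg N
  have hn0 : (0 : ℝ) ≤ n := Nat.cast_nonneg n
  have key : ∀ c' : ℝ, c ≤ c' / δ → ENNReal.ofReal (Real.exp (-c' * N)) ≤
      ENNReal.ofReal (Real.exp (-c * n)) := by
    intro c' hc'
    apply ENNReal.ofReal_le_ofReal
    apply Real.exp_le_exp.2
    rw [le_div_iff₀ hδ] at hc'
    have := mul_le_mul_of_nonneg_right hc' hN0
    rw [hn]; linarith
  have key' : ∀ c' : ℝ, c ≤ c' → ENNReal.ofReal (Real.exp (-c' * n)) ≤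
      ENNReal.ofReal (Real.exp (-c * n)) := by
    intro c' hc'
    apply ENNReal.ofReal_le_ofReal
    apply Real.exp_le_exp.2
    have := mul_le_mul_of_nonneg_right hc' hn0
    linarith
  have hsqb : ∀ z : ℝ, |z ^ 2| ≤ 1 * (1 + z ^ 2) := fun z => by
    rw [abs_of_nonneg (by positivity)]; linarith
  constructor
  · have e1 := (H1 N (fun _ z => z ^ 2) N (fun _ => by fun_prop) (fun _ => hsqb)
      (by simp [integral_sq_gaussianReal])).trans (key c1 h1)
    have e3 := (H3 N (fun j => certDist α t (θ j)) (N * m) (fun j => measurable_certDist _ _ _)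
      (fun j => abs_certDist_le hα.le _ _) hθ).trans (key c3 h3)
    have e4 := (H4 N (fun _ z => max (|z| - a) 0 ^ 2) (N * (δ / 512)) (fun _ => by fun_prop)
      (fun _ => abs_max_abs_sub_sq_le ha.le)
      (by simpa using mul_le_mul_of_nonneg_left hatail hN0)).trans (key c4 h4)
    have e5 := (H5 N (fun j z => -(clip a z * smallPart M (θ j))) 0
      (fun _ => by unfold clip; fun_prop)
      (fun j z => by
        rw [abs_neg, abs_mul]
        calc |clip a z| * |smallPart M (θ j)| ≤ a * M :=
              mul_le_mul (abs_clip_le ha.le _) (abs_smallPart_le hM.le _) (abs_nonneg _) ha.le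
          _ ≤ a * M * (1 + z ^ 2) := le_mul_of_one_le_right (by positivity)
              (by linarith [sq_nonneg z]))
      (by simp [integral_neg, integral_mul_const, integral_clip_gaussianReal ha.le])).trans
      (key c5 h5)
    have hsub : {g : Fin N → ℝ | ¬ (∑ j, g j ^ 2 ≤ 4 * N ∧
          ∑ j, certDist α t (θ j) (g j) ≤ b1 ^ 2 * n ∧
          ∑ j, max (|g j| - a) 0 ^ 2 ≤ (n : ℝ) / 256 ∧
          ∑ j, -(clip a (g j) * smallPart M (θ j)) ≤ σ / 16 * n)} ⊆
        ({g | (N : ℝ) + 3 * N ≤ ∑ j, g j ^ 2} ∪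
          {g | N * m + (b1 ^ 2 * δ - m) * N ≤ ∑ j, certDist α t (θ j) (g j)}) ∪
        ({g | N * (δ / 512) + δ / 512 * N ≤ ∑ j, max (|g j| - a) 0 ^ 2} ∪
          {g | 0 + σ / 16 * δ * N ≤ ∑ j, -(clip a (g j) * smallPart M (θ j))}) := by
      intro g hg
      by_contra hcon
      simp only [Set.mem_union, Set.mem_ofPred_eq, not_or, not_le] at hcon
      obtain ⟨⟨k1, k2⟩, k3, k4⟩ := hcon
      refine hg ⟨by linarith, ?_, ?_, ?_⟩
      · rw [hn]; linarith
      · rw [hn]; linarith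
      · rw [hn]; linarith
    refine (measure_mono hsub).trans ((measure_union_le _ _).trans
      ((add_le_add ((measure_union_le _ _).trans (add_le_add e1 e3))
        ((measure_union_le _ _).trans (add_le_add e4 e5))).trans ?_))
    have hp := (Real.exp_pos (-c * n)).le
    rw [← ENNReal.ofReal_add hp hp, ← ENNReal.ofReal_add (by positivity) (by positivity)]
    apply ENNReal.ofReal_le_ofReal
    linarith
  · have e1 := (H1 n (fun _ z => z ^ 2) n (fun _ => by fun_prop) (fun _ => hsqb)
      (by simp [integral_sq_gaussianReal])).trans (key' c1 h1')
    have e2 := (H2 n (fun _ z => -z ^ 2) (-n) (fun _ => by fun_prop)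
      (fun _ z => by rw [abs_neg]; exact hsqb z)
      (by simp [integral_neg, integral_sq_gaussianReal])).trans (key' c2 h2)
    have hsub : {h : Fin n → ℝ | ¬ (b2 ^ 2 * n ≤ ∑ i, h i ^ 2 ∧ ∑ i, h i ^ 2 ≤ 4 * n)} ⊆
        {h | (n : ℝ) + 3 * n ≤ ∑ i, h i ^ 2} ∪
          {h | -(n : ℝ) + (1 - b2 ^ 2) * n ≤ ∑ i, -h i ^ 2} := by
      intro h hh
      by_contra hcon
      simp only [Set.mem_union, Set.mem_ofPred_eq, not_or, not_le, Finset.sum_neg_distrib] at hcon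
      exact hh ⟨by linarith [hcon.2], by linarith [hcon.1]⟩
    refine (measure_mono hsub).trans ((measure_union_le _ _).trans ((add_le_add e1 e2).trans ?_))
    have hp := (Real.exp_pos (-c * n)).le
    rw [← ENNReal.ofReal_add hp hp]
    apply ENNReal.ofReal_le_ofReal
    linarith

/-- Theorem (existence, a.s. uniqueness, and local stability of the minimizer
of Gordon's auxiliary cost). -/
theorem stmt12 (δ σ lmin lmax q : ℝ)
    (hδ : 0 < δ) (hσ : 0 < σ) (hl : 0 < lmin) (hll : lmin ≤ lmax)
    (Dfam : (M : ℕ) → Set (Fin M → ℝ))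
    (hD : DFamSpec δ Dfam q) :
    (∀ (N n : ℕ), 0 < N → 0 < n →
      ∀ (θstar : Fin N → ℝ), ∀ lam ∈ Set.Icc lmin lmax,
      (∀ (g : Fin N → ℝ) (h : Fin n → ℝ) (g' : ℝ),
        ∃ w, IsMinOn (gordonL n N σ lam θstar g h g') Set.univ w) ∧
      (∀ᵐ ω ∂(Pgordon n N),
        ∃! w, IsMinOn (gordonL n N σ lam θstar ω.1 ω.2.1 ω.2.2) Set.univ w)) ∧
    ∃ γ c C : ℝ, 0 < γ ∧ 0 < c ∧ 0 < C ∧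
      ∀ (N n : ℕ), 0 < N → (n : ℝ) = δ * N →
      ∀ θstar ∈ Dfam N, ∀ lam ∈ Set.Icc lmin lmax,
      ∀ ε : ℝ, ε ∈ Set.Ioc (0 : ℝ) 1 →
      Pgordon n N
        {ω | ∃ w wstar : Fin N → ℝ,
          IsMinOn (gordonL n N σ lam θstar ω.1 ω.2.1 ω.2.2) Set.univ wstar ∧
          ε < (1 / (N : ℝ)) * ∑ j, (w j - wstar j) ^ 2 ∧
          gordonL n N σ lam θstar ω.1 ω.2.1 ω.2.2 w ≤
            gordonL n N σ lam θstar ω.1 ω.2.1 ω.2.2 wstar + γ * ε}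
      ≤ ENNReal.ofReal (C / ε * Real.exp (-c * n * ε ^ 2)) := by
  refine ⟨fun N n hN hn θ lam hlam => ⟨fun g h g' => ?_, ?_⟩, ?_⟩
  · rw [gordonL_eq_gordonCost]
    exact exists_isMinOn_gordonCost (by exact_mod_cast hn) (hl.trans_le hlam.1)
  · have hn' : (0 : ℝ) < n := by exact_mod_cast hn
    filter_upwards [Pgordon_ae_sum_sq_pos (N := N) hn] with ω hω
    rw [gordonL_eq_gordonCost]
    obtain ⟨w, hw⟩ := exists_isMinOn_gordonCost (n := n) (σ := σ) (lam := lam)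
      (A := √(∑ i, ω.2.1 i ^ 2) / √n) (b := ω.2.2 * σ / √n) (θ := θ) (g := ω.1) hn'
      (hl.trans_le hlam.1)
    exact ⟨w, hw, fun v hv => isMinOn_gordonCost_unique hn' hσ (hl.trans_le hlam.1)
      (by positivity) hv hw⟩
  · obtain ⟨α, t, m, hα, ht, hm, hcert⟩ := exists_certDist_bound hδ hD
    set ρ := max (m / δ) 0 with hρ
    have hρ0 : 0 ≤ ρ := le_max_right _ _
    have hρ1 : ρ < 1 := max_lt ((div_lt_one hδ).2 hm) one_pos
    have hmρ : m ≤ ρ * δ := (div_le_iff₀ hδ).1 (le_max_left _ _)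
    set b1 := √((2 * ρ + 1) / 3) with hb1
    set b2 := √((ρ + 2) / 3) with hb2
    have hb1sq : b1 ^ 2 = (2 * ρ + 1) / 3 := Real.sq_sqrt (by positivity)
    have hb2sq : b2 ^ 2 = (ρ + 2) / 3 := Real.sq_sqrt (by positivity)
    have hb12 : b1 < b2 := Real.sqrt_lt_sqrt (by positivity) (by linarith)
    have hb2' : 3 / 4 ≤ b2 := Real.le_sqrt_of_sq_le (by linarith)
    obtain ⟨a, ha, hatail⟩ := exists_integral_tail_le (e := δ / 512) (by positivity)
    obtain ⟨M, γ, hM, hγ, hstab⟩ := exists_stability_constants hδ hσ hl hll hα ht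
      (Real.sqrt_nonneg _) hb12 hb2' ha
    obtain ⟨c, hc, hev⟩ := exists_gaussian_event_bounds (t := t) (m := m) (b1 := b1) (b2 := b2)
      hδ hσ hα (by rw [hb1sq]; nlinarith) ha hatail hM (by linarith)
    set I := ∫ z : ℝ, Real.exp ((1 + z ^ 2) / 8) ∂gaussianReal 0 1 with hI
    have hI0 : 0 < I := integral_exp_pos integrable_exp_sq_gaussianReal
    refine ⟨γ, min c (1 / 2048), 6 + I, hγ, by positivity, by positivity, ?_⟩
    intro N n hN hn θ hθ lam hlam ε hε
    obtain ⟨hG, hH⟩ := hev N n θ hn (hcert N hN θ hθ)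
    have hZ := gaussianReal_sq_tail_le n
    have hN' : (0 : ℝ) < N := by exact_mod_cast hN
    have hn' : (0 : ℝ) < n := by rw [hn]; positivity
    have hsn : 0 < √(n : ℝ) := Real.sqrt_pos.2 hn'
    refine (Pgordon_le_add ?_).trans ((add_le_add hG (add_le_add hH hZ)).trans ?_)
    · rintro ⟨g, h, g'⟩ ⟨w, u, hu, hw, hle⟩
      simp only at hu hw hle
      rw [gordonL_eq_gordonCost] at hu hle
      by_contra hcon
      simp only [Set.mem_ofPred_eq, not_or, not_not, not_lt] at hcon
      obtain ⟨⟨k1, k2, k3, k4⟩, ⟨k5, k6⟩, k7⟩ := hcon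
      refine absurd hle (not_le.2 (hstab N n lam _ _ θ g hN hn hlam.1 hlam.2 ?_ ?_ ?_ k1 k2 k3 k4
        ε u w hε.1 hε.2 hu hw))
      · rw [← Real.sqrt_div (by positivity)]
        exact Real.le_sqrt_of_sq_le ((le_div_iff₀ hn').2 k5)
      · rw [← Real.sqrt_div (by positivity), Real.sqrt_le_iff]
        exact ⟨by norm_num, (div_le_iff₀ hn').2 (by linarith)⟩
      · have h1 : |g'| ≤ √(n : ℝ) / 16 := by
          refine abs_le_of_sq_le_sq ?_ (by positivity)
          rw [div_pow, Real.sq_sqrt hn'.le]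
          linarith
        rw [abs_div, abs_mul, abs_of_pos hσ, abs_of_pos hsn, div_le_iff₀ hsn]
        calc |g'| * σ ≤ √(n : ℝ) / 16 * σ := by gcongr
          _ = _ := by ring
    · rw [← ENNReal.ofReal_add (by positivity) (by positivity),
        ← ENNReal.ofReal_add (by positivity) (by positivity)]
      apply ENNReal.ofReal_le_ofReal
      have hε2 : ε ^ 2 ≤ 1 := pow_le_one₀ hε.1.le hε.2
      set d := min c (1 / 2048) with hd
      have hd0 : 0 < d := by positivity
      set E := Real.exp (-d * n * ε ^ 2) with hE
      have hdε : d * n * ε ^ 2 ≤ d * n * 1 := by gcongr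
      have e1 : Real.exp (-c * n) ≤ E := by
        apply Real.exp_le_exp.2
        have := mul_le_mul_of_nonneg_right (min_le_left c (1 / 2048)) hn'.le
        linarith
      have e2 : Real.exp (-(1 / 2048) * n) ≤ E := by
        apply Real.exp_le_exp.2
        have := mul_le_mul_of_nonneg_right (min_le_right c (1 / 2048)) hn'.le
        linarith
      have e3 : 6 + I ≤ (6 + I) / ε := le_div_self (by positivity) hε.1 hε.2
      calc _ ≤ 4 * E + (2 * E + I * E) := by gcongr
        _ = (6 + I) * E := by ring
        _ ≤ _ := by gcongr
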